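/- Suppose (X_i)_{i∈ℤ} is a strictly stationary sequence of ℝ^d-valued random vectors with α(k) = O(a^k) as k → ∞ for some a ∈ (0,1) and continuous marginal c.d.f.s. Then Condition 4.1 holds with θ₁ = 1/2 and Condition 4.3 holds with θ₂ = 1/2 and θ₃ = 1; explicitly: (i) for every μ ∈ (0,1/2) and every sequence δ_n → 0, sup_{|u−v| ≤ δ_n} |α_n(u) − α_n(v)| / ( |u−v|^μ ∨ n^{−μ} ) = o_P(1); (ii) for every ω ∈ (0,1/2), every λ ∈ (0,1) and every j = 1,…,d, sup_{s∈(0,1)} |α_{nj}(s)| / (s(1−s))^ω = O_P(1) and sup_{s∈(n^{−λ}, 1−n^{−λ})} |β_{nj}(s)| / (s(1−s))^ω = O_P(1). -/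

import Mathlib

open MeasureTheory Filter Set
open scoped ENNReal NNReal

noncomputable section

namespace BBV

variable {Ω : Type*} [MeasurableSpace Ω] {E : Type*} [MeasurableSpace E] {d : ℕ}

/-- The real-valued indicator function of a set. -/
def indic {α : Type*} (s : Set α) (x : α) : ℝ := s.indicator (fun _ => (1 : ℝ)) x

/-- `Z n = o_P(r n)`: convergence to zero in (outer) probability at rate `r`. -/
def oP (P : Measure Ω) (Z : ℕ → Ω → ℝ) (r : ℕ → ℝ) : Prop :=
  ∀ ε : ℝ, 0 < ε → Tendsto (fun n => P {ω | ε * r n < |Z n ω|}) atTop (nhds 0)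

/-- `Z n = o_P(1)`: convergence to zero in (outer) probability. -/
def oP1 (P : Measure Ω) (Z : ℕ → Ω → ℝ) : Prop := oP P Z fun _ => 1

/-- `Z n = O_P(1)`: boundedness in (outer) probability. -/
def bigOP (P : Measure Ω) (Z : ℕ → Ω → ℝ) : Prop :=
  ∀ ε : ℝ, 0 < ε → ∃ M : ℝ, ∀ᶠ n in atTop, P {ω | M < |Z n ω|} ≤ ENNReal.ofReal ε

/-- Strict stationarity of a two-sided sequence: all finite-dimensional distributions
are invariant under shifts. -/
def StrictlyStationary (P : Measure Ω) (X : ℤ → Ω → E) : Prop :=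
  ∀ (m : ℕ) (idx : Fin m → ℤ) (k : ℤ),
    Measure.map (fun ω (p : Fin m) => X (idx p + k) ω) P =
      Measure.map (fun ω (p : Fin m) => X (idx p) ω) P

/-- The sigma-field generated by the variables `X i`, `i ∈ S`. -/
def mixSigma (X : ℤ → Ω → E) (S : Set ℤ) : MeasurableSpace Ω :=
  ⨆ i ∈ S, MeasurableSpace.comap (X i) inferInstance

/-- The alpha-mixing coefficient of the sequence `X`. -/
def alphaMix (P : Measure Ω) (X : ℤ → Ω → E) (k : ℕ) : ℝ :=
  sSup {r : ℝ | ∃ (i : ℤ) (A B : Set Ω),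
    MeasurableSet[mixSigma X (Set.Iic i)] A ∧
    MeasurableSet[mixSigma X (Set.Ici (i + (k : ℤ)))] B ∧
    r = |(P (A ∩ B)).toReal - (P A).toReal * (P B).toReal|}

/-- Exponentially decaying alpha-mixing coefficients: `α(k) = O(a^k)` for some `a ∈ (0,1)`. -/
def ExpAlphaMixing (P : Measure Ω) (X : ℤ → Ω → E) : Prop :=
  ∃ a ∈ Set.Ioo (0 : ℝ) 1, ∃ c : ℝ, ∀ k : ℕ, 1 ≤ k → alphaMix P X k ≤ c * a ^ k

/-- Marginal c.d.f. `F_j` of the stationary sequence. -/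
def margF (P : Measure Ω) (X : ℤ → Ω → Fin d → ℝ) (j : Fin d) (x : ℝ) : ℝ :=
  (P {ω | X 0 ω j ≤ x}).toReal

/-- `U_i = (F_1(X_{i1}),…,F_d(X_{id}))`. -/
def Uv (P : Measure Ω) (X : ℤ → Ω → Fin d → ℝ) (i : ℤ) (ω : Ω) (j : Fin d) : ℝ :=
  margF P X j (X i ω j)

/-- The copula `C` of the stationary distribution, i.e. the c.d.f. of `U_0`. -/
def cop (P : Measure Ω) (X : ℤ → Ω → Fin d → ℝ) (u : Fin d → ℝ) : ℝ :=
  (P {ω | ∀ j, Uv P X 0 ω j ≤ u j}).toReal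

/-- Empirical c.d.f. `G_n` of the (unobservable) sample `U_1,…,U_n`. -/
def Gn (P : Measure Ω) (X : ℤ → Ω → Fin d → ℝ) (n : ℕ) (u : Fin d → ℝ) (ω : Ω) : ℝ :=
  (n : ℝ)⁻¹ * ∑ i ∈ Finset.Icc (1 : ℤ) (n : ℤ), indic {ω' | ∀ j, Uv P X i ω' j ≤ u j} ω

/-- The empirical process `α_n = √n (G_n − C)`. -/
def alphan (P : Measure Ω) (X : ℤ → Ω → Fin d → ℝ) (n : ℕ) (u : Fin d → ℝ) (ω : Ω) : ℝ :=
  Real.sqrt n * (Gn P X n u ω - cop P X u)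

/-- Marginal empirical c.d.f. `G_{nj}` based on `U_{1j},…,U_{nj}`. -/
def Gnj (P : Measure Ω) (X : ℤ → Ω → Fin d → ℝ) (n : ℕ) (j : Fin d) (s : ℝ) (ω : Ω) : ℝ :=
  (n : ℝ)⁻¹ * ∑ i ∈ Finset.Icc (1 : ℤ) (n : ℤ), indic {ω' | Uv P X i ω' j ≤ s} ω

/-- The marginal empirical process `α_{nj}(s) = √n (G_{nj}(s) − s)`. -/
def alphanj (P : Measure Ω) (X : ℤ → Ω → Fin d → ℝ) (n : ℕ) (j : Fin d) (s : ℝ) (ω : Ω) : ℝ :=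
  Real.sqrt n * (Gnj P X n j s ω - s)

/-- Left-continuous generalized inverse: `H⁻(s) = inf{x : H(x) ≥ s}` for `s ≠ 0`,
and `H⁻(0) = sup{x : H(x) = 0}`. -/
def genInv (H : ℝ → ℝ) (s : ℝ) : ℝ :=
  if s = 0 then sSup {x | H x = 0} else sInf {x | s ≤ H x}

/-- The marginal quantile process `β_{nj}(s) = √n (G_{nj}⁻(s) − s)`. -/
def betanj (P : Measure Ω) (X : ℤ → Ω → Fin d → ℝ) (n : ℕ) (j : Fin d) (s : ℝ) (ω : Ω) : ℝ :=
  Real.sqrt n * (genInv (fun x => Gnj P X n j x ω) s - s)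

/-- Marginal empirical c.d.f. `F_{nj}` of the observations `X_{1j},…,X_{nj}`. -/
def empCdfX (X : ℤ → Ω → Fin d → ℝ) (n : ℕ) (j : Fin d) (x : ℝ) (ω : Ω) : ℝ :=
  (n : ℝ)⁻¹ * ∑ i ∈ Finset.Icc (1 : ℤ) (n : ℤ), indic {ω' | X i ω' j ≤ x} ω

/-- Pseudo-observations `Û_{ij} = n/(n+1) · F_{nj}(X_{ij})`. -/
def pseudoObs (X : ℤ → Ω → Fin d → ℝ) (n : ℕ) (i : ℤ) (ω : Ω) (j : Fin d) : ℝ :=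
  (n : ℝ) / ((n : ℝ) + 1) * empCdfX X n j (X i ω j) ω

/-- The empirical copula `Ĉ_n`. -/
def empCop (X : ℤ → Ω → Fin d → ℝ) (n : ℕ) (u : Fin d → ℝ) (ω : Ω) : ℝ :=
  (n : ℝ)⁻¹ * ∑ i ∈ Finset.Icc (1 : ℤ) (n : ℤ), indic {ω' | ∀ j, pseudoObs X n i ω' j ≤ u j} ω

/-- The empirical copula process `ĈP_n = √n (Ĉ_n − C)`. -/
def hatCP (P : Measure Ω) (X : ℤ → Ω → Fin d → ℝ) (n : ℕ) (u : Fin d → ℝ) (ω : Ω) : ℝ :=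
  Real.sqrt n * (empCop X n u ω - cop P X u)

/-- First-order partial derivative `Ċ_j` of `C`, defined everywhere as the limsup of
difference quotients (which coincides with the partial derivative wherever it exists). -/
def Cdot (C : (Fin d → ℝ) → ℝ) (j : Fin d) (u : Fin d → ℝ) : ℝ :=
  Filter.limsup (fun h : ℝ => (C (Function.update u j (u j + h)) - C u) / h)
    (nhdsWithin 0 {(0 : ℝ)}ᶜ)

/-- The process `C̄_n(u) = α_n(u) − Σ_j Ċ_j(u) α_n(u^{(j)})`. -/
def Cbar (P : Measure Ω) (X : ℤ → Ω → Fin d → ℝ) (n : ℕ) (u : Fin d → ℝ) (ω : Ω) : ℝ :=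
  alphan P X n u ω -
    ∑ j, Cdot (cop P X) j u * alphan P X n (Function.update (fun _ => (1 : ℝ)) j (u j)) ω

/-- `C_n(u) = G_n(G_{n1}⁻(u₁),…,G_{nd}⁻(u_d))`. -/
def copGI (P : Measure Ω) (X : ℤ → Ω → Fin d → ℝ) (n : ℕ) (u : Fin d → ℝ) (ω : Ω) : ℝ :=
  Gn P X n (fun j => genInv (fun x => Gnj P X n j x ω) (u j)) ω

/-- The empirical copula process `𝔺_n = √n (C_n − C)` based on generalized inverses. -/
def CPgi (P : Measure Ω) (X : ℤ → Ω → Fin d → ℝ) (n : ℕ) (u : Fin d → ℝ) (ω : Ω) : ℝ :=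
  Real.sqrt n * (copGI P X n u ω - cop P X u)

/-- `g₁(u) = min{ min_j u_j , min_j [1 − min_{k ≠ j} u_k] }`. -/
def g1 (u : Fin d → ℝ) : ℝ :=
  min (⨅ j, u j) (⨅ j : Fin d, (1 - ⨅ k : {k : Fin d // k ≠ j}, u (k : Fin d)))

/-- The weight function `g_ω(u) = g₁(u)^ω`. -/
def gW (w : ℝ) (u : Fin d → ℝ) : ℝ := g1 u ^ w

/-- `g̃_ω(u) = g_ω(u) + 1{g_ω(u) = 0}`. -/
def gTilde (w : ℝ) (u : Fin d → ℝ) : ℝ := if gW w u = 0 then 1 else gW w u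

/-- `N(a,b) = {u ∈ [0,1]^d : a < g₁(u) ≤ b}`. -/
def NN (d : ℕ) (a b : ℝ) : Set (Fin d → ℝ) :=
  {u | (∀ j, 0 ≤ u j ∧ u j ≤ 1) ∧ a < g1 u ∧ g1 u ≤ b}

/-- `V_j = {u ∈ [0,1]^d : u_j ∈ (0,1)}`. -/
def VV (d : ℕ) (j : Fin d) : Set (Fin d → ℝ) :=
  {u | (∀ k, 0 ≤ u k ∧ u k ≤ 1) ∧ 0 < u j ∧ u j < 1}

/-- Condition 2.1: existence, continuity and growth bounds for the first and second
order partial derivatives of the copula `C`. -/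
def Condition21 (C : (Fin d → ℝ) → ℝ) : Prop :=
  (∀ j : Fin d, ∀ u ∈ VV d j,
    HasDerivAt (fun t => C (Function.update u j t)) (Cdot C j u) (u j)) ∧
  (∀ j : Fin d, ContinuousOn (Cdot C j) (VV d j)) ∧
  ∃ Cdd : Fin d → Fin d → (Fin d → ℝ) → ℝ,
    (∀ j₁ j₂ : Fin d, ∀ u ∈ VV d j₁ ∩ VV d j₂,
      HasDerivAt (fun t => Cdot C j₂ (Function.update u j₁ t)) (Cdd j₁ j₂ u) (u j₁)) ∧
    (∀ j₁ j₂ : Fin d, ContinuousOn (Cdd j₁ j₂) (VV d j₁ ∩ VV d j₂)) ∧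
    ∃ K : ℝ, 0 < K ∧ ∀ j₁ j₂ : Fin d, ∀ u ∈ VV d j₁ ∩ VV d j₂,
      |Cdd j₁ j₂ u| ≤ K * min (1 / (u j₁ * (1 - u j₁))) (1 / (u j₂ * (1 - u j₂)))

/-- The weighted modulus of continuity `M_n(δ,μ)` of the empirical process. -/
def Mn (P : Measure Ω) (X : ℤ → Ω → Fin d → ℝ) (n : ℕ) (δ μ : ℝ) (ω : Ω) : ℝ :=
  ⨆ q ∈ {q : (Fin d → ℝ) × (Fin d → ℝ) |
      q.1 ∈ Set.Icc 0 1 ∧ q.2 ∈ Set.Icc 0 1 ∧ dist q.1 q.2 ≤ δ},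
    |alphan P X n q.1 ω - alphan P X n q.2 ω| / max (dist q.1 q.2 ^ μ) ((n : ℝ) ^ (-μ))

/-- Condition 4.1 with parameter `θ₁`. -/
def Condition41 (P : Measure Ω) (X : ℤ → Ω → Fin d → ℝ) (θ₁ : ℝ) : Prop :=
  ∀ μ ∈ Set.Ioo (0 : ℝ) θ₁, ∀ δ : ℕ → ℝ, Tendsto δ atTop (nhds 0) →
    oP1 P (fun n ω => Mn P X n (δ n) μ ω)

/-- Condition 4.3 with parameters `θ₂, θ₃`. -/
def Condition43 (P : Measure Ω) (X : ℤ → Ω → Fin d → ℝ) (θ₂ θ₃ : ℝ) : Prop :=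
  ∀ w ∈ Set.Ioo (0 : ℝ) θ₂, ∀ lam ∈ Set.Ioo (0 : ℝ) θ₃, ∀ j : Fin d,
    bigOP P (fun n ω => ⨆ s ∈ Set.Ioo (0 : ℝ) 1,
      |alphanj P X n j s ω| / (s * (1 - s)) ^ w) ∧
    bigOP P (fun n ω => ⨆ s ∈ Set.Ioo ((n : ℝ) ^ (-lam)) (1 - (n : ℝ) ^ (-lam)),
      |betanj P X n j s ω| / (s * (1 - s)) ^ w)

set_option linter.unusedSectionVars false

/-! ### Summing mixed moments over ordered tuples -/

lemma geom_sum_le_inv {c : ℝ} (hc0 : 0 ≤ c) (hc1 : c < 1) (n : ℕ) :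
    ∑ k ∈ Finset.range n, c ^ k ≤ (1 - c)⁻¹ := by
  rw [← tsum_geometric_of_lt_one hc0 hc1]
  exact (summable_geometric_of_lt_one hc0 hc1).sum_le_tsum _ fun _ _ => pow_nonneg hc0 _

lemma sum_pow_dist_le {c : ℝ} (hc0 : 0 ≤ c) (hc1 : c < 1) (n y : ℕ) :
    ∑ x : Fin n, c ^ Nat.dist y x ≤ 2 * (1 - c)⁻¹ := by
  rw [Fin.sum_univ_eq_sum_range (fun x => c ^ Nat.dist y x) n]
  have h1 : ∑ x ∈ Finset.range n, c ^ Nat.dist y x ≤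
      ∑ x ∈ Finset.range (y + n), c ^ Nat.dist y x :=
    Finset.sum_le_sum_of_subset_of_nonneg (Finset.range_mono (by omega))
      fun _ _ _ => pow_nonneg hc0 _
  have h2 : ∑ x ∈ Finset.range y, c ^ Nat.dist y x ≤ (1 - c)⁻¹ := by
    rw [← Finset.sum_range_reflect]
    refine le_trans (Finset.sum_le_sum fun x hx => ?_) (geom_sum_le_inv hc0 hc1 y)
    have := Finset.mem_range.1 hx
    exact pow_le_pow_of_le_one hc0 hc1.le (by simp only [Nat.dist]; omega)
  have h3 : ∑ x ∈ Finset.range n, c ^ Nat.dist y (y + x) ≤ (1 - c)⁻¹ := by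
    refine le_trans (Finset.sum_le_sum fun x _ => ?_) (geom_sum_le_inv hc0 hc1 n)
    exact pow_le_pow_of_le_one hc0 hc1.le (by simp only [Nat.dist]; omega)
  rw [Finset.sum_range_add] at h1
  linarith

lemma sum_prod_pow_dist_le {c : ℝ} (hc0 : 0 ≤ c) (hc1 : c < 1) (n q : ℕ) :
    ∑ f : Fin (q + 1) → Fin n, ∏ j : Fin q, c ^ Nat.dist (f j.succ) (f j.castSucc) ≤
      n * (2 * (1 - c)⁻¹) ^ q := by
  induction q with
  | zero => simp
  | succ q ih =>
    rw [← (Fin.consEquiv (n := q + 1) (fun _ => Fin n)).sum_comp, Fintype.sum_prod_type_right]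
    have hpos : 0 ≤ 2 * (1 - c)⁻¹ := by
      have : 0 < 1 - c := by linarith
      positivity
    calc _ = ∑ g : Fin (q + 1) → Fin n, (∑ x : Fin n, c ^ Nat.dist (g 0) x) *
            ∏ j : Fin q, c ^ Nat.dist (g j.succ) (g j.castSucc) := by
          refine Finset.sum_congr rfl fun g _ => ?_
          rw [Finset.sum_mul]
          refine Finset.sum_congr rfl fun x _ => ?_
          rw [Fin.prod_univ_succ]
          simp [Fin.consEquiv]
      _ ≤ ∑ g : Fin (q + 1) → Fin n, (2 * (1 - c)⁻¹) *
            ∏ j : Fin q, c ^ Nat.dist (g j.succ) (g j.castSucc) := by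
          refine Finset.sum_le_sum fun g _ => ?_
          exact mul_le_mul_of_nonneg_right (sum_pow_dist_le hc0 hc1 n _)
            (Finset.prod_nonneg fun _ _ => pow_nonneg hc0 _)
      _ ≤ _ := by
          rw [← Finset.mul_sum, pow_succ']
          calc _ ≤ (2 * (1 - c)⁻¹) * (n * (2 * (1 - c)⁻¹) ^ q) := mul_le_mul_of_nonneg_left ih hpos
            _ = _ := by ring

lemma sum_split_tuple {α : Type*} [Fintype α] {Q a b : ℕ} (h : Q = a + b)
    (G : (Fin a → α) → ℝ) (H : (Fin b → α) → ℝ) :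
    ∑ f : Fin Q → α, G (fun i => f ⟨i, by omega⟩) * H (fun i => f ⟨a + i, by omega⟩) =
      (∑ f, G f) * ∑ f, H f := by
  subst h
  rw [← (Fin.appendEquiv a b).sum_comp, Fintype.sum_prod_type, Finset.sum_mul_sum]
  refine Finset.sum_congr rfl fun f _ => Finset.sum_congr rfl fun g _ => ?_
  congr 2 <;> funext i
  · exact Fin.append_left f g i
  · exact Fin.append_right f g i

open Classical in
/-- The sum of `|φ|` over nondecreasing tuples. -/
def orderedSum {n : ℕ} (φ : ∀ Q, (Fin Q → Fin n) → ℝ) (Q : ℕ) : ℝ :=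
  ∑ f : Fin Q → Fin n, if Monotone f then |φ Q f| else 0

/-- A weak dependence condition on a family of mixed moments: single factors are centred, and
splitting an ordered tuple at a gap costs an error that is geometric in the gap. -/
structure GeomSplit {n : ℕ} (B b : ℝ) (φ : ∀ Q, (Fin Q → Fin n) → ℝ) : Prop where
  zero_le : ∀ f, |φ 0 f| ≤ 1
  one : ∀ f, φ 1 f = 0
  split : ∀ (q : ℕ) (m : Fin (q + 1)) (f : Fin (q + 2) → Fin n), Monotone f →
    |φ (q + 2) f - φ (m + 1) (fun i => f ⟨i, by omega⟩) *
      φ (q - m + 1) (fun i => f ⟨m + 1 + i, by omega⟩)| ≤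
      B * b ^ ((f m.succ : ℕ) - f m.castSucc)

lemma orderedSum_nonneg {n : ℕ} (φ : ∀ Q, (Fin Q → Fin n) → ℝ) (Q : ℕ) :
    0 ≤ orderedSum φ Q :=
  Finset.sum_nonneg fun f _ => by split_ifs <;> positivity

lemma GeomSplit.abs_le {n : ℕ} {B b c : ℝ} {φ : ∀ Q, (Fin Q → Fin n) → ℝ}
    (h : GeomSplit B b φ) (hB : 0 ≤ B) (hc0 : 0 ≤ c) (hc1 : c ≤ 1) {q : ℕ}
    (hcb : c ^ (q + 1) = b) {f : Fin (q + 2) → Fin n} (hf : Monotone f) :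
    |φ (q + 2) f| ≤
      (∑ m : Fin (q + 1), |φ (m + 1) (fun i => f ⟨i, by omega⟩)| *
        |φ (q - m + 1) (fun i => f ⟨m + 1 + i, by omega⟩)|) +
      B * ∏ j : Fin (q + 1), c ^ Nat.dist (f j.succ) (f j.castSucc) := by
  obtain ⟨m, hm⟩ := Finite.exists_max fun j : Fin (q + 1) => Nat.dist (f j.succ) (f j.castSucc)
  have hs := h.split q m f hf
  have hdist : Nat.dist (f m.succ) (f m.castSucc) = (f m.succ : ℕ) - f m.castSucc := by
    have : f m.castSucc ≤ f m.succ := hf (Fin.castSucc_lt_succ).le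
    have : (f m.castSucc : ℕ) ≤ f m.succ := this
    simp only [Nat.dist]; omega
  have hpow : b ^ ((f m.succ : ℕ) - f m.castSucc) ≤
      ∏ j : Fin (q + 1), c ^ Nat.dist (f j.succ) (f j.castSucc) := by
    rw [← hdist, ← hcb, Finset.prod_pow_eq_pow_sum, ← pow_mul]
    refine pow_le_pow_of_le_one hc0 hc1 ?_
    refine (Finset.sum_le_card_nsmul _ _ _ fun j _ => hm j).trans ?_
    simp
  have h1 : |φ (m + 1) (fun i => f ⟨i, by omega⟩)| *
        |φ (q - m + 1) (fun i => f ⟨m + 1 + i, by omega⟩)| ≤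
      ∑ m : Fin (q + 1), |φ (m + 1) (fun i => f ⟨i, by omega⟩)| *
        |φ (q - m + 1) (fun i => f ⟨m + 1 + i, by omega⟩)| :=
    Finset.single_le_sum
      (f := fun m : Fin (q + 1) => |φ (m + 1) (fun i => f ⟨i, by omega⟩)| *
        |φ (q - m + 1) (fun i => f ⟨m + 1 + i, by omega⟩)|)
      (fun _ _ => by positivity) (Finset.mem_univ m)
  rw [← abs_mul] at h1
  have h2 := mul_le_mul_of_nonneg_left hpow hB
  have h3 := abs_sub_abs_le_abs_sub (φ (q + 2) f) (φ (m + 1) (fun i => f ⟨i, by omega⟩) *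
      φ (q - m + 1) (fun i => f ⟨m + 1 + i, by omega⟩))
  linarith

lemma GeomSplit.orderedSum_succ_le {n : ℕ} {B b c : ℝ} {φ : ∀ Q, (Fin Q → Fin n) → ℝ}
    (h : GeomSplit B b φ) (hB : 0 ≤ B) (hc0 : 0 ≤ c) (hc1 : c < 1) {q : ℕ}
    (hcb : c ^ (q + 1) = b) :
    orderedSum φ (q + 2) ≤
      (∑ m : Fin (q + 1), orderedSum φ (m + 1) * orderedSum φ (q - m + 1)) +
        B * (n * (2 * (1 - c)⁻¹) ^ (q + 1)) := by
  classical
  calc orderedSum φ (q + 2)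
      ≤ ∑ f : Fin (q + 2) → Fin n, ((∑ m : Fin (q + 1),
          (if Monotone (fun i : Fin (m + 1) => f ⟨i, by omega⟩) then
            |φ (m + 1) (fun i => f ⟨i, by omega⟩)| else 0) *
          (if Monotone (fun i : Fin (q - m + 1) => f ⟨m + 1 + i, by omega⟩) then
            |φ (q - m + 1) (fun i => f ⟨m + 1 + i, by omega⟩)| else 0)) +
          B * ∏ j : Fin (q + 1), c ^ Nat.dist (f j.succ) (f j.castSucc)) := by
        refine Finset.sum_le_sum fun f _ => ?_
        split_ifs with hf
        · refine (h.abs_le hB hc0 hc1.le hcb hf).trans (le_of_eq ?_)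
          congr 1
          refine Finset.sum_congr rfl fun m _ => ?_
          rw [if_pos, if_pos]
          · exact fun i j hij => hf (Fin.mk_le_mk.2 (Nat.add_le_add_left hij _))
          · exact fun i j hij => hf (Fin.mk_le_mk.2 hij)
        · refine add_nonneg (Finset.sum_nonneg fun m _ => mul_nonneg ?_ ?_)
            (mul_nonneg hB (Finset.prod_nonneg fun _ _ => pow_nonneg hc0 _)) <;>
          split_ifs <;> positivity
    _ = (∑ m : Fin (q + 1), orderedSum φ (m + 1) * orderedSum φ (q - m + 1)) +
        B * ∑ f : Fin (q + 2) → Fin n,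
          ∏ j : Fin (q + 1), c ^ Nat.dist (f j.succ) (f j.castSucc) := by
        rw [Finset.sum_add_distrib, Finset.sum_comm, Finset.mul_sum]
        congr 1
        refine Finset.sum_congr rfl fun m _ => ?_
        exact sum_split_tuple (a := m + 1) (b := q - m + 1) (by omega)
          (fun g => if Monotone g then |φ (m + 1) g| else 0)
          (fun g => if Monotone g then |φ (q - m + 1) g| else 0)
    _ ≤ _ := by
        gcongr
        exact sum_prod_pow_dist_le hc0 hc1 n (q + 1)

lemma exists_orderedSum_le {b : ℝ} (hb0 : 0 ≤ b) (hb1 : b < 1) (Q : ℕ) :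
    ∃ C : ℝ, 0 ≤ C ∧ ∀ (n : ℕ) (B y : ℝ) (φ : ∀ Q, (Fin Q → Fin n) → ℝ), 0 ≤ B → 1 ≤ y →
      n * B ≤ y ^ 2 → GeomSplit B b φ → orderedSum φ Q ≤ C * y ^ Q := by
  induction Q using Nat.strong_induction_on with
  | _ Q ih =>
    match Q, ih with
    | 0, _ =>
      refine ⟨1, zero_le_one, fun n B y φ _ _ _ h => ?_⟩
      have := h.zero_le
      simp only [orderedSum, Finset.univ_unique, Finset.sum_singleton, pow_zero, mul_one]
      split_ifs
      · exact this _
      · exact zero_le_one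
    | 1, _ =>
      refine ⟨0, le_rfl, fun n B y φ _ _ _ h => ?_⟩
      simp [orderedSum, h.one]
    | q + 2, ih =>
      set c : ℝ := b ^ (((q + 1 : ℕ) : ℝ)⁻¹) with hc
      have hc0 : 0 ≤ c := Real.rpow_nonneg hb0 _
      have hc1 : c < 1 := Real.rpow_lt_one hb0 hb1 (by positivity)
      have hcb : c ^ (q + 1) = b := Real.rpow_inv_natCast_pow hb0 (by omega)
      have hpos : 0 ≤ 2 * (1 - c)⁻¹ := by
        have : 0 < 1 - c := by linarith
        positivity
      choose! K hK0 hK using ih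
      refine ⟨(∑ m : Fin (q + 1), K (m + 1) * K (q - m + 1)) + (2 * (1 - c)⁻¹) ^ (q + 1), ?_, ?_⟩
      · exact add_nonneg (Finset.sum_nonneg fun m _ =>
          mul_nonneg (hK0 _ (by omega)) (hK0 _ (by omega))) (by positivity)
      intro n B y φ hB hy hny h
      refine (h.orderedSum_succ_le hB hc0 hc1 hcb).trans ?_
      rw [add_mul, Finset.sum_mul]
      refine add_le_add (Finset.sum_le_sum fun m _ => ?_) ?_
      · have h1 := hK (m + 1) (by omega) n B y φ hB hy hny h
        have h2 := hK (q - m + 1) (by omega) n B y φ hB hy hny h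
        calc _ ≤ (K (m + 1) * y ^ ((m : ℕ) + 1)) * (K (q - m + 1) * y ^ (q - m + 1)) :=
              mul_le_mul h1 h2 (orderedSum_nonneg _ _)
                (mul_nonneg (hK0 _ (by omega)) (by positivity))
          _ = K (m + 1) * K (q - m + 1) * y ^ (((m : ℕ) + 1) + (q - m + 1)) := by
              rw [pow_add]; ring
          _ = _ := by
              have : ((m : ℕ) + 1) + (q - m + 1) = q + 2 := by omega
              rw [this]
      · calc B * (n * (2 * (1 - c)⁻¹) ^ (q + 1)) = (2 * (1 - c)⁻¹) ^ (q + 1) * (n * B) := by ring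
          _ ≤ (2 * (1 - c)⁻¹) ^ (q + 1) * y ^ (q + 2) := by
              gcongr
              exact hny.trans (pow_le_pow_right₀ hy (by omega))

/-- Summing a symmetric functional over all tuples costs a factor `Q!` over ordered tuples. -/
lemma sum_abs_le_factorial_mul {n : ℕ} (φ : ∀ Q, (Fin Q → Fin n) → ℝ) (Q : ℕ)
    (hsymm : ∀ (f : Fin Q → Fin n) (σ : Equiv.Perm (Fin Q)), φ Q (f ∘ σ) = φ Q f) :
    ∑ f : Fin Q → Fin n, |φ Q f| ≤ Q.factorial * orderedSum φ Q := by
  classical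
  calc ∑ f : Fin Q → Fin n, |φ Q f|
      ≤ ∑ f : Fin Q → Fin n, ∑ σ : Equiv.Perm (Fin Q),
          if Monotone (f ∘ σ) then |φ Q (f ∘ σ)| else 0 := by
        refine Finset.sum_le_sum fun f _ => ?_
        refine le_trans (le_of_eq ?_) (Finset.single_le_sum
          (f := fun σ : Equiv.Perm (Fin Q) => if Monotone (f ∘ σ) then |φ Q (f ∘ σ)| else 0)
          (fun σ _ => by split_ifs <;> positivity) (Finset.mem_univ (Tuple.sort f)))
        rw [if_pos (Tuple.monotone_sort f), hsymm]
    _ = ∑ σ : Equiv.Perm (Fin Q), orderedSum φ Q := by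
        rw [Finset.sum_comm]
        refine Finset.sum_congr rfl fun σ _ => ?_
        exact (Equiv.arrowCongr σ.symm (Equiv.refl (Fin n))).sum_comp
          fun f => if Monotone f then |φ Q f| else 0
    _ = _ := by simp [Fintype.card_perm]

/-! ### Covariance inequality under strong mixing -/

lemma exists_abs_integral_mul_le {Ω : Type*} {m mΩ : MeasurableSpace Ω} {P : Measure Ω}
    [IsProbabilityMeasure P] (hm : m ≤ mΩ) {U h : Ω → ℝ}
    (hU : StronglyMeasurable[m] U) (hU1 : ∀ ω, |U ω| ≤ 1) (hh : Integrable h P)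
    (h0 : ∫ ω, h ω ∂P = 0) :
    ∃ A, MeasurableSet[m] A ∧ |∫ ω, U ω * h ω ∂P| ≤ 2 * |∫ ω in A, h ω ∂P| := by
  set g := P[h | m] with hg
  have hgm : StronglyMeasurable[m] g := stronglyMeasurable_condExp
  have hgi : Integrable g P := integrable_condExp
  have hA : MeasurableSet[m] {ω | 0 ≤ g ω} := measurableSet_le measurable_const hgm.measurable
  refine ⟨{ω | 0 ≤ g ω}, hA, ?_⟩
  have hUh : Integrable (U * h) P :=
    hh.bdd_mul (hU.mono hm).aestronglyMeasurable (ae_of_all _ hU1)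
  have h1 : ∫ ω, U ω * h ω ∂P = ∫ ω, U ω * g ω ∂P := by
    have := condExp_mul_of_stronglyMeasurable_left hU hUh hh
    calc ∫ ω, U ω * h ω ∂P = ∫ ω, (P[U * h | m]) ω ∂P := (integral_condExp hm).symm
      _ = ∫ ω, U ω * g ω ∂P := integral_congr_ae this
  have h2 : |∫ ω, U ω * g ω ∂P| ≤ ∫ ω, |g ω| ∂P := by
    refine (abs_integral_le_integral_abs).trans ?_
    refine integral_mono_of_nonneg (ae_of_all _ fun _ => abs_nonneg _) hgi.abs
      (ae_of_all _ fun ω => ?_)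
    simp only [abs_mul]
    exact mul_le_of_le_one_left (abs_nonneg _) (hU1 ω)
  have h3 : ∫ ω, |g ω| ∂P = 2 * ∫ ω in {ω | 0 ≤ g ω}, g ω ∂P := by
    have hsplit := integral_add_compl (hm _ hA) hgi
    have hzero : ∫ ω, g ω ∂P = 0 := by rw [hg, integral_condExp hm, h0]
    rw [← integral_add_compl (hm _ hA) hgi.abs,
      setIntegral_congr_fun (hm _ hA) (g := g) fun ω hω => abs_of_nonneg hω,
      setIntegral_congr_fun (hm _ hA).compl (g := fun ω => - g ω)
        fun ω hω => abs_of_neg (not_le.1 hω), integral_neg]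
    linarith
  rw [h1]
  refine h2.trans ?_
  rw [h3, hg, setIntegral_condExp hm hh hA]
  gcongr
  exact le_abs_self _

lemma abs_covariance_le {Ω : Type*} {m₁ m₂ mΩ : MeasurableSpace Ω} {P : Measure Ω}
    [IsProbabilityMeasure P] (hm₁ : m₁ ≤ mΩ) (hm₂ : m₂ ≤ mΩ) {α : ℝ}
    (hα : ∀ A B, MeasurableSet[m₁] A → MeasurableSet[m₂] B →
      |P.real (A ∩ B) - P.real A * P.real B| ≤ α) {U V : Ω → ℝ}
    (hU : StronglyMeasurable[m₁] U) (hU1 : ∀ ω, |U ω| ≤ 1)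
    (hV : StronglyMeasurable[m₂] V) (hV1 : ∀ ω, |V ω| ≤ 1) :
    |∫ ω, U ω * V ω ∂P - (∫ ω, U ω ∂P) * ∫ ω, V ω ∂P| ≤ 4 * α := by
  have hUi : Integrable U P :=
    .of_bound (hU.mono hm₁).aestronglyMeasurable 1 (ae_of_all _ hU1)
  have hVi : Integrable V P :=
    .of_bound (hV.mono hm₂).aestronglyMeasurable 1 (ae_of_all _ hV1)
  have hUV : Integrable (fun ω => U ω * V ω) P :=
    hVi.bdd_mul (hU.mono hm₁).aestronglyMeasurable (ae_of_all _ hU1)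
  obtain ⟨A, hA, hAle⟩ := exists_abs_integral_mul_le hm₁ hU hU1
    (h := fun ω => V ω - ∫ ω, V ω ∂P) (hVi.sub (integrable_const _))
    (by rw [integral_sub hVi (integrable_const _)]; simp)
  have hAi : Integrable (A.indicator fun _ => (1 : ℝ)) P :=
    (integrable_const _).indicator (hm₁ _ hA)
  obtain ⟨B, hB, hBle⟩ := exists_abs_integral_mul_le hm₂ hV hV1
    (h := fun ω => A.indicator (fun _ => (1 : ℝ)) ω - P.real A) (hAi.sub (integrable_const _))
    (by rw [integral_sub hAi (integrable_const _), integral_indicator_const _ (hm₁ _ hA)]; simp)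
  have e1 : ∫ ω, U ω * (V ω - ∫ ω, V ω ∂P) ∂P =
      ∫ ω, U ω * V ω ∂P - (∫ ω, U ω ∂P) * ∫ ω, V ω ∂P := by
    simp only [mul_sub]
    rw [integral_sub hUV (hUi.mul_const _), integral_mul_const]
  have e2 : ∫ ω in A, (V ω - ∫ ω, V ω ∂P) ∂P =
      ∫ ω, V ω * (A.indicator (fun _ => (1 : ℝ)) ω - P.real A) ∂P := by
    have hVA : Integrable (fun ω => V ω * A.indicator (fun _ => (1 : ℝ)) ω) P :=
      hAi.bdd_mul (hV.mono hm₂).aestronglyMeasurable (ae_of_all _ hV1)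
    simp only [mul_sub]
    rw [integral_sub hVA (hVi.mul_const _), integral_mul_const,
      integral_sub hVi.integrableOn (integrable_const _), setIntegral_const, smul_eq_mul,
      ← integral_indicator (hm₁ _ hA), mul_comm (P.real A)]
    congr 2
    funext ω
    by_cases h : ω ∈ A <;> simp [h]
  have e3 : ∫ ω in B, (A.indicator (fun _ => (1 : ℝ)) ω - P.real A) ∂P =
      P.real (A ∩ B) - P.real A * P.real B := by
    rw [integral_sub hAi.integrableOn (integrable_const _), setIntegral_const, smul_eq_mul,
      integral_indicator_const _ (hm₁ _ hA), smul_eq_mul, mul_one,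
      measureReal_restrict_apply (hm₁ _ hA), mul_comm]
  rw [e1, e2] at hAle
  rw [e3] at hBle
  have := hα A B hA hB
  linarith

lemma mixSigma_le {X : ℤ → Ω → E} (hX : ∀ i, Measurable (X i)) (S : Set ℤ) :
    mixSigma X S ≤ ‹MeasurableSpace Ω› :=
  iSup₂_le fun i _ => (hX i).comap_le

lemma measurable_mixSigma {X : ℤ → Ω → E} {S : Set ℤ} {i : ℤ} (hi : i ∈ S) :
    Measurable[mixSigma X S] (X i) :=
  Measurable.mono (comap_measurable (X i)) (le_iSup₂_of_le i hi le_rfl) le_rfl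

lemma abs_measureReal_inter_sub_le {P : Measure Ω} [IsProbabilityMeasure P] (A B : Set Ω) :
    |P.real (A ∩ B) - P.real A * P.real B| ≤ 1 := by
  rw [abs_le]
  have h1 : P.real (A ∩ B) ≤ 1 := measureReal_le_one
  have h2 : P.real A * P.real B ≤ 1 :=
    mul_le_one₀ measureReal_le_one measureReal_nonneg measureReal_le_one
  have h3 : 0 ≤ P.real A * P.real B := by positivity
  have h4 : 0 ≤ P.real (A ∩ B) := measureReal_nonneg
  constructor <;> linarith

lemma le_alphaMix {P : Measure Ω} [IsProbabilityMeasure P] {X : ℤ → Ω → E} {k : ℕ} {i j : ℤ}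
    (hij : i + k ≤ j) {A B : Set Ω}
    (hA : MeasurableSet[mixSigma X (Set.Iic i)] A)
    (hB : MeasurableSet[mixSigma X (Set.Ici j)] B) :
    |P.real (A ∩ B) - P.real A * P.real B| ≤ alphaMix P X k := by
  refine le_csSup ⟨1, ?_⟩ ⟨i, A, B, hA, ?_, rfl⟩
  · rintro _ ⟨i, A, B, -, -, rfl⟩
    exact abs_measureReal_inter_sub_le A B
  · have : mixSigma X (Set.Ici j) ≤ mixSigma X (Set.Ici (i + k)) :=
      biSup_mono fun l hl => hij.trans hl
    exact this _ hB

/-! ### Moment and tail bounds for centred indicator sums -/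

/-- The centred indicator `1(X i ∈ A) - P(X 0 ∈ A)`. -/
def centredIndic (P : Measure Ω) (X : ℤ → Ω → E) (A : Set E) (i : ℤ) (ω : Ω) : ℝ :=
  A.indicator (fun _ => (1 : ℝ)) (X i ω) - P.real {ω | X 0 ω ∈ A}

/-- The sum of the centred indicators of `A` over `X 1, …, X n`. -/
def centredSum (P : Measure Ω) (X : ℤ → Ω → E) (A : Set E) (n : ℕ) (ω : Ω) : ℝ :=
  ∑ i : Fin n, centredIndic P X A ((i : ℕ) + 1) ω

/-- The mixed moments of the centred indicators of `A`. -/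
def mixedMoment (P : Measure Ω) (X : ℤ → Ω → E) (A : Set E) (n Q : ℕ) (f : Fin Q → Fin n) : ℝ :=
  ∫ ω, ∏ i, centredIndic P X A ((f i : ℕ) + 1) ω ∂P

lemma StrictlyStationary.measureReal_eq {P : Measure Ω} {X : ℤ → Ω → E}
    (hX : ∀ i, Measurable (X i)) (hs : StrictlyStationary P X) {A : Set E}
    (hA : MeasurableSet A) (i : ℤ) : P.real {ω | X i ω ∈ A} = P.real {ω | X 0 ω ∈ A} := by
  have h := hs 1 (fun _ => 0) i
  have hS : MeasurableSet {x : Fin 1 → E | x 0 ∈ A} := measurable_pi_apply 0 hA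
  have h1 := congrArg (fun μ => μ {x : Fin 1 → E | x 0 ∈ A}) h
  rw [Measure.map_apply (measurable_pi_lambda _ fun _ => hX _) hS,
    Measure.map_apply (measurable_pi_lambda _ fun _ => hX _) hS] at h1
  simp only [Set.preimage_ofPred_eq, zero_add] at h1
  simp only [measureReal_def, h1]

section Moments

variable {P : Measure Ω} [IsProbabilityMeasure P] {X : ℤ → Ω → E} {A : Set E}

lemma abs_centredIndic_le_one (i : ℤ) (ω : Ω) : |centredIndic P X A i ω| ≤ 1 := by
  have h0 : 0 ≤ P.real {ω | X 0 ω ∈ A} := measureReal_nonneg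
  have h1 : P.real {ω | X 0 ω ∈ A} ≤ 1 := measureReal_le_one
  unfold centredIndic
  by_cases h : X i ω ∈ A <;> simp only [h, Set.indicator_of_mem, not_false_eq_true,
    Set.indicator_of_notMem] <;> rw [abs_le] <;> constructor <;> linarith

lemma measurable_centredIndic_mixSigma (hA : MeasurableSet A) {S : Set ℤ} {i : ℤ} (hi : i ∈ S) :
    Measurable[mixSigma X S] (centredIndic P X A i) :=
  Measurable.sub_const ((measurable_const.indicator hA).comp (measurable_mixSigma hi)) _

lemma measurable_centredIndic (hX : ∀ i, Measurable (X i)) (hA : MeasurableSet A) (i : ℤ) :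
    Measurable (centredIndic P X A i) :=
  Measurable.sub_const ((measurable_const.indicator hA).comp (hX i)) _

lemma integrable_indicator_comp (hX : ∀ i, Measurable (X i)) (hA : MeasurableSet A) (i : ℤ) :
    Integrable (fun ω => A.indicator (fun _ => (1 : ℝ)) (X i ω)) P := by
  refine .of_bound ((measurable_const.indicator hA).comp (hX i)).aestronglyMeasurable 1
    (ae_of_all _ fun ω => ?_)
  by_cases h : X i ω ∈ A <;> simp [h]

lemma integral_indicator_comp (hX : ∀ i, Measurable (X i)) (hs : StrictlyStationary P X)
    (hA : MeasurableSet A) (i : ℤ) :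
    ∫ ω, A.indicator (fun _ => (1 : ℝ)) (X i ω) ∂P = P.real {ω | X 0 ω ∈ A} := by
  have h : (fun ω => A.indicator (fun _ => (1 : ℝ)) (X i ω)) =
      (X i ⁻¹' A).indicator fun _ => (1 : ℝ) := by
    funext ω
    by_cases h : X i ω ∈ A <;> simp [h]
  rw [h, integral_indicator_const _ (hX i hA), smul_eq_mul, mul_one, ← hs.measureReal_eq hX hA i]
  rfl

lemma integral_centredIndic (hX : ∀ i, Measurable (X i)) (hs : StrictlyStationary P X)
    (hA : MeasurableSet A) (i : ℤ) : ∫ ω, centredIndic P X A i ω ∂P = 0 := by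
  simp only [centredIndic]
  rw [integral_sub (integrable_indicator_comp hX hA i) (integrable_const _),
    integral_indicator_comp hX hs hA]
  simp

lemma integral_abs_centredIndic_le (hX : ∀ i, Measurable (X i)) (hs : StrictlyStationary P X)
    (hA : MeasurableSet A) (i : ℤ) :
    ∫ ω, |centredIndic P X A i ω| ∂P ≤ 2 * P.real {ω | X 0 ω ∈ A} := by
  have h : ∫ ω, |centredIndic P X A i ω| ∂P ≤
      ∫ ω, (A.indicator (fun _ => (1 : ℝ)) (X i ω) + P.real {ω | X 0 ω ∈ A}) ∂P := by
    refine integral_mono_of_nonneg (ae_of_all _ fun _ => abs_nonneg _)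
      ((integrable_indicator_comp hX hA i).add (integrable_const _)) (ae_of_all _ fun ω => ?_)
    have h1 : 0 ≤ A.indicator (fun _ => (1 : ℝ)) (X i ω) :=
      Set.indicator_nonneg (fun _ _ => zero_le_one) _
    have h2 : 0 ≤ P.real {ω | X 0 ω ∈ A} := measureReal_nonneg
    simp only [centredIndic]
    rw [abs_le]
    constructor <;> linarith
  rw [integral_add (integrable_indicator_comp hX hA i) (integrable_const _),
    integral_indicator_comp hX hs hA] at h
  simpa [two_mul] using h

lemma abs_prod_centredIndic_le_one {ι : Type*} (s : Finset ι) (g : ι → ℤ) (ω : Ω) :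
    |∏ i ∈ s, centredIndic P X A (g i) ω| ≤ 1 := by
  rw [Finset.abs_prod]
  exact Finset.prod_le_one (fun _ _ => abs_nonneg _) fun _ _ => abs_centredIndic_le_one _ _

lemma abs_mixedMoment_le_one {n Q : ℕ} (f : Fin Q → Fin n) : |mixedMoment P X A n Q f| ≤ 1 := by
  have h := norm_integral_le_of_norm_le_const (μ := P)
    (f := fun ω => ∏ i, centredIndic P X A ((f i : ℕ) + 1) ω) (C := 1)
    (ae_of_all _ fun ω => abs_prod_centredIndic_le_one _ _ ω)
  simpa [mixedMoment] using h

lemma abs_mixedMoment_succ_le (hX : ∀ i, Measurable (X i)) (hs : StrictlyStationary P X)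
    (hA : MeasurableSet A) {n Q : ℕ} (f : Fin (Q + 1) → Fin n) :
    |mixedMoment P X A n (Q + 1) f| ≤ 2 * P.real {ω | X 0 ω ∈ A} := by
  refine le_trans ?_ (integral_abs_centredIndic_le hX hs hA ((f 0 : ℕ) + 1))
  refine abs_integral_le_integral_abs.trans ?_
  refine integral_mono_of_nonneg (ae_of_all _ fun _ => abs_nonneg _) ?_ (ae_of_all _ fun ω => ?_)
  · exact (Integrable.of_bound (measurable_centredIndic hX hA _).aestronglyMeasurable 1
      (ae_of_all _ fun ω => abs_centredIndic_le_one _ _)).abs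
  · simp only [Fin.prod_univ_succ, abs_mul]
    exact mul_le_of_le_one_right (abs_nonneg _) (abs_prod_centredIndic_le_one _ _ ω)

lemma prod_split_tuple {Q a b : ℕ} (h : Q = a + b) (g : Fin Q → ℝ) :
    ∏ i, g i = (∏ i : Fin a, g ⟨i, by omega⟩) * ∏ i : Fin b, g ⟨a + i, by omega⟩ := by
  subst h
  exact Fin.prod_univ_add g

lemma abs_mixedMoment_sub_le (hX : ∀ i, Measurable (X i)) (hA : MeasurableSet A)
    {n q : ℕ} (m : Fin (q + 1)) {f : Fin (q + 2) → Fin n} (hf : Monotone f) :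
    |mixedMoment P X A n (q + 2) f - mixedMoment P X A n (m + 1) (fun i => f ⟨i, by omega⟩) *
      mixedMoment P X A n (q - m + 1) (fun i => f ⟨m + 1 + i, by omega⟩)| ≤
      4 * alphaMix P X ((f m.succ : ℕ) - f m.castSucc) := by
  have hprod : mixedMoment P X A n (q + 2) f =
      ∫ ω, (∏ i : Fin (m + 1), centredIndic P X A ((f ⟨i, by omega⟩ : ℕ) + 1) ω) *
        ∏ i : Fin (q - m + 1), centredIndic P X A ((f ⟨m + 1 + i, by omega⟩ : ℕ) + 1) ω ∂P := by
    refine integral_congr_ae (ae_of_all _ fun ω => ?_)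
    exact prod_split_tuple (a := m + 1) (b := q - m + 1) (by omega)
      fun i => centredIndic P X A ((f i : ℕ) + 1) ω
  rw [hprod]
  have hle : f m.castSucc ≤ f m.succ := hf (Fin.castSucc_lt_succ).le
  have hle' : (f m.castSucc : ℕ) ≤ f m.succ := hle
  refine abs_covariance_le (mixSigma_le hX (Set.Iic ((f m.castSucc : ℕ) + 1 : ℤ)))
    (mixSigma_le hX (Set.Ici ((f m.succ : ℕ) + 1 : ℤ)))
    (fun B C hB hC => le_alphaMix (by omega) hB hC)
    (Measurable.stronglyMeasurable ?_) (fun ω => abs_prod_centredIndic_le_one _ _ ω)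
    (Measurable.stronglyMeasurable ?_) (fun ω => abs_prod_centredIndic_le_one _ _ ω)
  · refine Finset.measurable_fun_prod _ fun i _ => measurable_centredIndic_mixSigma hA ?_
    have h1 : f ⟨i, by omega⟩ ≤ f m.castSucc :=
      hf (Fin.mk_le_mk.2 (by omega))
    have h2 : (f ⟨i, by omega⟩ : ℕ) ≤ f m.castSucc := h1
    simp only [Set.mem_Iic]
    omega
  · refine Finset.measurable_fun_prod _ fun i _ => measurable_centredIndic_mixSigma hA ?_
    have h1 : f m.succ ≤ f ⟨m + 1 + i, by omega⟩ :=
      hf (Fin.mk_le_mk.2 (by omega))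
    have h2 : (f m.succ : ℕ) ≤ f ⟨m + 1 + i, by omega⟩ := h1
    simp only [Set.mem_Ici]
    omega

lemma min_le_rpow_mul_rpow {x y γ : ℝ} (hx : 0 ≤ x) (hy : 0 ≤ y) (h0 : 0 < γ) (h1 : γ < 1) :
    min x y ≤ x ^ (1 - γ) * y ^ γ := by
  have hm : 0 ≤ min x y := le_min hx hy
  calc min x y = min x y ^ (1 - γ) * min x y ^ γ := by
        rw [← Real.rpow_add' hm (by norm_num), sub_add_cancel, Real.rpow_one]
    _ ≤ _ := by
        have h1' : 0 ≤ 1 - γ := by linarith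
        gcongr
        · exact min_le_left _ _
        · exact min_le_right _ _

lemma geomSplit_mixedMoment (hX : ∀ i, Measurable (X i)) (hs : StrictlyStationary P X)
    (hA : MeasurableSet A) {a c γ : ℝ} (ha0 : 0 < a) (hc : 1 ≤ c)
    (hmix : ∀ k : ℕ, 1 ≤ k → alphaMix P X k ≤ c * a ^ k) (h0 : 0 < γ) (h1 : γ < 1) (n : ℕ) :
    GeomSplit (4 * c ^ γ * P.real {ω | X 0 ω ∈ A} ^ (1 - γ)) (a ^ γ) (mixedMoment P X A n) where
  zero_le f := abs_mixedMoment_le_one f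
  one f := by
    simpa [mixedMoment] using integral_centredIndic hX hs hA ((f 0 : ℕ) + 1)
  split q m f hf := by
    set p := P.real {ω | X 0 ω ∈ A} with hp
    set g := (f m.succ : ℕ) - f m.castSucc with hg
    have hp0 : 0 ≤ p := measureReal_nonneg
    have hp1 : p ≤ 1 := measureReal_le_one
    have hb1 := abs_mixedMoment_sub_le (P := P) hX hA m hf
    have hb2 : |mixedMoment P X A n (q + 2) f -
        mixedMoment P X A n (m + 1) (fun i => f ⟨i, by omega⟩) *
        mixedMoment P X A n (q - m + 1) (fun i => f ⟨m + 1 + i, by omega⟩)| ≤ 4 * p := by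
      refine (abs_sub _ _).trans ?_
      rw [abs_mul]
      have e1 := abs_mixedMoment_succ_le hX hs hA f
      have e2 := mul_le_mul (abs_mixedMoment_succ_le hX hs hA
        (fun i : Fin (m + 1) => f ⟨i, by omega⟩))
        (abs_mixedMoment_le_one (P := P) (X := X) (A := A)
          (fun i : Fin (q - m + 1) => f ⟨m + 1 + i, by omega⟩)) (abs_nonneg _) (by positivity)
      linarith
    have hmin : |mixedMoment P X A n (q + 2) f -
        mixedMoment P X A n (m + 1) (fun i => f ⟨i, by omega⟩) *
        mixedMoment P X A n (q - m + 1) (fun i => f ⟨m + 1 + i, by omega⟩)| ≤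
        4 * min p (c * a ^ g) := by
      rcases Nat.eq_zero_or_pos g with h | h
      · rw [h, pow_zero, mul_one, min_eq_left (hp1.trans hc)]
        exact hb2
      · rw [mul_min_of_nonneg _ _ (by norm_num : (0 : ℝ) ≤ 4)]
        exact le_min hb2 (hb1.trans (by linarith [hmix g h]))
    refine hmin.trans ?_
    have := min_le_rpow_mul_rpow hp0 (by positivity : 0 ≤ c * a ^ g) h0 h1
    calc 4 * min p (c * a ^ g) ≤ 4 * (p ^ (1 - γ) * (c * a ^ g) ^ γ) := by gcongr
      _ = _ := by
        rw [Real.mul_rpow (by positivity) (by positivity), ← Real.rpow_natCast, ← Real.rpow_natCast,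
          ← Real.rpow_mul ha0.le, ← Real.rpow_mul ha0.le, mul_comm (g : ℝ)]
        ring

lemma exists_integral_centredSum_pow_le (hX : ∀ i, Measurable (X i))
    (hs : StrictlyStationary P X) (hmix : ExpAlphaMixing P X) {γ : ℝ} (h0 : 0 < γ) (h1 : γ < 1)
    (Q : ℕ) :
    ∃ C : ℝ, 0 ≤ C ∧ ∀ (n : ℕ) (A : Set E) (y : ℝ), MeasurableSet A → 1 ≤ y →
      n * P.real {ω | X 0 ω ∈ A} ^ (1 - γ) ≤ y ^ 2 →
      ∫ ω, centredSum P X A n ω ^ Q ∂P ≤ C * y ^ Q := by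
  obtain ⟨a, ⟨ha0, ha1⟩, c, hc⟩ := hmix
  set c' := max c 1 with hc'
  have hc1 : 1 ≤ c' := le_max_right _ _
  have hmix' : ∀ k : ℕ, 1 ≤ k → alphaMix P X k ≤ c' * a ^ k := fun k hk =>
    (hc k hk).trans (mul_le_mul_of_nonneg_right (le_max_left _ _) (by positivity))
  have hcγ : 1 ≤ c' ^ γ := Real.one_le_rpow hc1 h0.le
  obtain ⟨C, hC0, hC⟩ := exists_orderedSum_le (Real.rpow_nonneg ha0.le γ)
    (Real.rpow_lt_one ha0.le ha1 h0) Q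
  set D := 2 * √(c' ^ γ) with hD
  have hD2 : D ^ 2 = 4 * c' ^ γ := by
    rw [hD, mul_pow, Real.sq_sqrt (by positivity)]; norm_num
  have hD1 : 1 ≤ D := by
    have : 1 ≤ √(c' ^ γ) := Real.one_le_sqrt.2 hcγ
    linarith
  refine ⟨Q.factorial * (C * D ^ Q), by positivity, fun n A y hA hy hny => ?_⟩
  have hord := hC n _ (D * y) _ (by positivity) (one_le_mul_of_one_le_of_one_le hD1 hy)
    (by
      rw [mul_pow, hD2]
      calc _ = 4 * c' ^ γ * (n * P.real {ω | X 0 ω ∈ A} ^ (1 - γ)) := by ring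
        _ ≤ _ := by gcongr)
    (geomSplit_mixedMoment hX hs hA ha0 hc1 hmix' h0 h1 n)
  have hsum := sum_abs_le_factorial_mul (mixedMoment P X A n) Q fun f σ => by
    refine integral_congr_ae (ae_of_all _ fun ω => ?_)
    exact Equiv.prod_comp σ fun i => centredIndic P X A ((f i : ℕ) + 1) ω
  calc ∫ ω, centredSum P X A n ω ^ Q ∂P = ∑ f : Fin Q → Fin n, mixedMoment P X A n Q f := by
        simp only [centredSum, Fintype.sum_pow]
        rw [integral_finsetSum]
        · rfl
        · intro f _
          refine Integrable.of_bound (Measurable.aestronglyMeasurable ?_) 1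
            (ae_of_all _ fun ω => abs_prod_centredIndic_le_one _ _ ω)
          exact Finset.measurable_fun_prod _ fun i _ => measurable_centredIndic hX hA _
    _ ≤ ∑ f : Fin Q → Fin n, |mixedMoment P X A n Q f| :=
        Finset.sum_le_sum fun f _ => le_abs_self _
    _ ≤ Q.factorial * orderedSum (mixedMoment P X A n) Q := hsum
    _ ≤ Q.factorial * (C * (D * y) ^ Q) := by gcongr
    _ = _ := by rw [mul_pow]; ring

lemma abs_centredSum_le (n : ℕ) (ω : Ω) : |centredSum P X A n ω| ≤ n := by
  refine (Finset.abs_sum_le_sum_abs _ _).trans ?_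
  refine (Finset.sum_le_sum fun i _ => abs_centredIndic_le_one _ _).trans ?_
  simp

lemma measurable_centredSum (hX : ∀ i, Measurable (X i)) (hA : MeasurableSet A) (n : ℕ) :
    Measurable (centredSum P X A n) :=
  Finset.measurable_fun_sum _ fun _ _ => measurable_centredIndic hX hA _

lemma exists_measureReal_centredSum_le (hX : ∀ i, Measurable (X i))
    (hs : StrictlyStationary P X) (hmix : ExpAlphaMixing P X) {κ : ℝ} (h0 : 0 < κ)
    (h1 : κ < 1 / 2) (Q : ℕ) :
    ∃ C : ℝ, 0 ≤ C ∧ ∀ (n : ℕ) (A : Set E) (z t : ℝ), MeasurableSet A → 1 ≤ n → 0 < t →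
      (n : ℝ)⁻¹ ≤ z → P.real {ω | X 0 ω ∈ A} ≤ z →
      P.real {ω | t ≤ |(√n)⁻¹ * centredSum P X A n ω|} ≤ C * (z ^ κ / t) ^ (2 * Q) := by
  obtain ⟨C, hC0, hC⟩ := exists_integral_centredSum_pow_le hX hs hmix
    (γ := 1 - 2 * κ) (by linarith) (by linarith) (2 * Q)
  refine ⟨C, hC0, fun n A z t hA hn ht hnz hpz => ?_⟩
  have hn0 : (0 : ℝ) < n := by exact_mod_cast hn
  have hn1 : (1 : ℝ) ≤ n := by exact_mod_cast hn
  have hz : 0 < z := lt_of_lt_of_le (by positivity) hnz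
  have hsn : 0 < √(n : ℝ) := Real.sqrt_pos.2 hn0
  have hy2 : (√n * z ^ κ) ^ 2 = n * z ^ (2 * κ) := by
    rw [mul_pow, Real.sq_sqrt hn0.le, ← Real.rpow_natCast, ← Real.rpow_mul hz.le]
    push_cast
    rw [mul_comm κ]
  have hy1 : 1 ≤ √n * z ^ κ := by
    rw [← one_le_sq_iff₀ (by positivity), hy2]
    calc (1 : ℝ) ≤ n ^ (1 - 2 * κ) := Real.one_le_rpow hn1 (by linarith)
      _ = n * (n : ℝ)⁻¹ ^ (2 * κ) := by
          rw [Real.rpow_sub hn0, Real.rpow_one, Real.inv_rpow hn0.le]; rfl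
      _ ≤ n * z ^ (2 * κ) := by gcongr
  have hI := hC n A (√n * z ^ κ) hA hy1 (by
    rw [hy2, sub_sub_cancel]
    gcongr)
  have hmarkov := mul_meas_ge_le_integral_of_nonneg (μ := P)
    (f := fun ω => centredSum P X A n ω ^ (2 * Q))
    (ae_of_all _ fun ω => (even_two_mul Q).pow_nonneg _)
    (Integrable.of_bound ((measurable_centredSum hX hA n).pow_const _).aestronglyMeasurable
      ((n : ℝ) ^ (2 * Q)) (ae_of_all _ fun ω => by
        rw [norm_pow]
        exact pow_le_pow_left₀ (norm_nonneg _) (abs_centredSum_le n ω) _))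
    ((t * √n) ^ (2 * Q))
  have hsub : {ω | t ≤ |(√n)⁻¹ * centredSum P X A n ω|} ⊆
      {ω | (t * √n) ^ (2 * Q) ≤ centredSum P X A n ω ^ (2 * Q)} := by
    intro ω hω
    simp only [Set.mem_ofPred_eq, abs_mul, abs_inv, abs_of_pos hsn] at hω ⊢
    rw [← (even_two_mul Q).pow_abs (centredSum P X A n ω)]
    refine pow_le_pow_left₀ (by positivity) ?_ _
    rwa [inv_mul_eq_div, le_div_iff₀ hsn] at hω
  have hpos : 0 < (t * √n) ^ (2 * Q) := by positivity
  calc _ ≤ P.real {ω | (t * √n) ^ (2 * Q) ≤ centredSum P X A n ω ^ (2 * Q)} :=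
        measureReal_mono hsub
    _ ≤ (C * (√n * z ^ κ) ^ (2 * Q)) / (t * √n) ^ (2 * Q) := by
        rw [le_div_iff₀ hpos, mul_comm]
        exact hmarkov.trans hI
    _ = _ := by
        rw [mul_div_assoc, ← div_pow]
        congr 2
        field_simp

end Moments

/-! ### Uniform margins and the empirical process as a centred sum -/

lemma measureReal_cdf_le {μ : Measure ℝ} [IsProbabilityMeasure μ] {F : ℝ → ℝ}
    (hF : ∀ x, F x = μ.real (Set.Iic x)) (hc : Continuous F) {s : ℝ} (hs : s ∈ Set.Icc (0 : ℝ) 1) :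
    μ.real {x | F x ≤ s} = s := by
  have hcdf : F = ProbabilityTheory.cdf μ := by
    funext x
    rw [hF, ProbabilityTheory.cdf_eq_real]
  have hmono : Monotone F := hcdf ▸ ProbabilityTheory.monotone_cdf μ
  have hbot : Tendsto F atBot (nhds 0) := hcdf ▸ ProbabilityTheory.tendsto_cdf_atBot μ
  have htop : Tendsto F atTop (nhds 1) := hcdf ▸ ProbabilityTheory.tendsto_cdf_atTop μ
  have hsurj : ∀ t ∈ Set.Ioo (0 : ℝ) 1, ∃ x, F x = t := fun t ht =>
    mem_range_of_exists_le_of_exists_ge hc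
      ((hbot.eventually_lt_const ht.1).exists.imp fun _ h => h.le)
      ((htop.eventually_const_lt ht.2).exists.imp fun _ h => h.le)
  refine le_antisymm ?_ ?_
  · refine le_of_forall_pos_le_add fun ε hε => ?_
    rcases le_or_gt 1 (s + ε) with h | h
    · exact measureReal_le_one.trans h
    · obtain ⟨x, hx⟩ := hsurj (s + ε) ⟨by linarith [hs.1], h⟩
      rw [← hx, hF]
      refine measureReal_mono fun y (hy : F y ≤ s) => ?_
      by_contra hxy
      have := hmono (not_le.1 hxy).le
      linarith
  · refine le_of_forall_pos_le_add fun ε hε => ?_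
    rcases le_or_gt s ε with h | h
    · have : 0 ≤ μ.real {x | F x ≤ s} := measureReal_nonneg
      linarith
    · obtain ⟨x, hx⟩ := hsurj (s - ε) ⟨by linarith, by linarith [hs.2]⟩
      have : μ.real (Set.Iic x) ≤ μ.real {x | F x ≤ s} :=
        measureReal_mono fun y (hy : y ≤ x) => (hmono hy).trans (by linarith)
      rw [← hF, hx] at this
      linarith

/-- The set of observations whose marginal transforms lie in the lower orthant of `u`. -/
def orthantSet (P : Measure Ω) (X : ℤ → Ω → Fin d → ℝ) (u : Fin d → ℝ) : Set (Fin d → ℝ) :=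
  {x | ∀ j, margF P X j (x j) ≤ u j}

section Empirical

variable {P : Measure Ω} {X : ℤ → Ω → Fin d → ℝ}

lemma measurableSet_orthantSet (hcont : ∀ j, Continuous (margF P X j)) (u : Fin d → ℝ) :
    MeasurableSet (orthantSet P X u) := by
  simp only [orthantSet, Set.ofPred_forall]
  exact MeasurableSet.iInter fun j =>
    measurableSet_le ((hcont j).measurable.comp (measurable_pi_apply j)) measurable_const

lemma orthantSet_mono {u v : Fin d → ℝ} (h : v ≤ u) : orthantSet P X v ⊆ orthantSet P X u :=
  fun _ hx j => (hx j).trans (h j)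

lemma sum_Icc_one_eq_sum_fin (n : ℕ) (g : ℤ → ℝ) :
    ∑ i ∈ Finset.Icc (1 : ℤ) n, g i = ∑ i : Fin n, g ((i : ℕ) + 1) := by
  rw [Fin.sum_univ_eq_sum_range (fun i => g ((i : ℤ) + 1)) n]
  refine Finset.sum_nbij' (fun i => (i - 1).toNat) (fun i => (i : ℤ) + 1) ?_ ?_ ?_ ?_ ?_
  · intro i hi
    rw [Finset.mem_Icc] at hi
    rw [Finset.mem_range]
    omega
  · intro i hi
    rw [Finset.mem_range] at hi
    rw [Finset.mem_Icc]
    omega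
  · intro i hi
    rw [Finset.mem_Icc] at hi
    omega
  · intro i _
    omega
  · intro i hi
    rw [Finset.mem_Icc] at hi
    congr 1
    omega

lemma alphan_eq_centredSum {n : ℕ} (hn : 1 ≤ n) (u : Fin d → ℝ) (ω : Ω) :
    alphan P X n u ω = (√n)⁻¹ * centredSum P X (orthantSet P X u) n ω := by
  have hn0 : (0 : ℝ) < n := by exact_mod_cast hn
  have hsum : centredSum P X (orthantSet P X u) n ω =
      (∑ i ∈ Finset.Icc (1 : ℤ) n, indic {ω' | ∀ j, Uv P X i ω' j ≤ u j} ω) - n * cop P X u := by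
    rw [sum_Icc_one_eq_sum_fin]
    simp only [centredSum, centredIndic, Finset.sum_sub_distrib, Finset.sum_const,
      Finset.card_univ, Fintype.card_fin, nsmul_eq_mul]
    rfl
  rw [hsum, alphan, Gn]
  have h2 : √(n : ℝ) ≠ 0 := (Real.sqrt_pos.2 hn0).ne'
  have h3 : √(n : ℝ) * √n = n := Real.mul_self_sqrt hn0.le
  field_simp
  rw [sq, h3]

lemma alphan_sub_eq_centredSum [IsProbabilityMeasure P] (hX : ∀ i, Measurable (X i))
    (hcont : ∀ j, Continuous (margF P X j)) {n : ℕ} (hn : 1 ≤ n) {u v : Fin d → ℝ} (h : v ≤ u)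
    (ω : Ω) : alphan P X n u ω - alphan P X n v ω =
      (√n)⁻¹ * centredSum P X (orthantSet P X u \ orthantSet P X v) n ω := by
  rw [alphan_eq_centredSum hn, alphan_eq_centredSum hn, ← mul_sub]
  congr 1
  simp only [centredSum, ← Finset.sum_sub_distrib]
  refine Finset.sum_congr rfl fun i _ => ?_
  have h1 : P.real {ω | X 0 ω ∈ orthantSet P X u \ orthantSet P X v} =
      P.real {ω | X 0 ω ∈ orthantSet P X u} - P.real {ω | X 0 ω ∈ orthantSet P X v} :=
    measureReal_sdiff (fun ω hω => orthantSet_mono h hω)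
      (hX 0 (measurableSet_orthantSet hcont v))
  simp only [centredIndic, h1, Set.indicator_sdiff (orthantSet_mono h), Pi.sub_apply]
  ring

variable [IsProbabilityMeasure P]

lemma measureReal_Uv_le (hX : ∀ i, Measurable (X i)) (hcont : ∀ j, Continuous (margF P X j))
    (j : Fin d) {s : ℝ} (hs : s ∈ Set.Icc (0 : ℝ) 1) : P.real {ω | Uv P X 0 ω j ≤ s} = s := by
  have hm : Measurable fun ω => X 0 ω j := (measurable_pi_apply j).comp (hX 0)
  have := Measure.isProbabilityMeasure_map (μ := P) hm.aemeasurable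
  have h := measureReal_cdf_le (μ := P.map fun ω => X 0 ω j) (F := margF P X j) (fun x => by
    rw [map_measureReal_apply hm measurableSet_Iic]; rfl) (hcont j) hs
  rwa [map_measureReal_apply hm (measurableSet_le (hcont j).measurable measurable_const)] at h

lemma measureReal_Uv_mem_Ioc (hX : ∀ i, Measurable (X i)) (hs : StrictlyStationary P X)
    (hcont : ∀ j, Continuous (margF P X j)) (i : ℤ)
    (j : Fin d) {s t : ℝ} (h0 : 0 ≤ s) (hst : s ≤ t) (h1 : t ≤ 1) :
    P.real {ω | Uv P X i ω j ∈ Set.Ioc s t} = t - s := by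
  have hm : MeasurableSet {x : Fin d → ℝ | margF P X j (x j) ≤ s} :=
    measurableSet_le ((hcont j).measurable.comp (measurable_pi_apply j)) measurable_const
  have hm' : MeasurableSet {x : Fin d → ℝ | margF P X j (x j) ∈ Set.Ioc s t} :=
    (hcont j).measurable.comp (measurable_pi_apply j) measurableSet_Ioc
  have h2 : P.real {ω | Uv P X i ω j ∈ Set.Ioc s t} =
      P.real {ω | Uv P X 0 ω j ∈ Set.Ioc s t} := hs.measureReal_eq hX hm' i
  have h3 : {ω | Uv P X 0 ω j ∈ Set.Ioc s t} =
      {ω | Uv P X 0 ω j ≤ t} \ {ω | Uv P X 0 ω j ≤ s} := by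
    ext ω
    simp [and_comm]
  have hsub : {ω | Uv P X 0 ω j ≤ s} ⊆ {ω | Uv P X 0 ω j ≤ t} := fun ω hω => le_trans hω hst
  have hms : MeasurableSet {ω | Uv P X 0 ω j ≤ s} := hX 0 hm
  rw [h2, h3, measureReal_sdiff hsub hms,
    measureReal_Uv_le hX hcont j ⟨h0.trans hst, h1⟩,
    measureReal_Uv_le hX hcont j ⟨h0, hst.trans h1⟩]

lemma measureReal_orthantSet_sdiff_le (hX : ∀ i, Measurable (X i))
    (hs : StrictlyStationary P X) (hcont : ∀ j, Continuous (margF P X j)) {u v : Fin d → ℝ}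
    (hv : 0 ≤ v) (hvu : v ≤ u) (hu : u ≤ 1) :
    P.real {ω | X 0 ω ∈ orthantSet P X u \ orthantSet P X v} ≤ ∑ j, (u j - v j) := by
  calc _ ≤ P.real (⋃ j ∈ Finset.univ, {ω | Uv P X 0 ω j ∈ Set.Ioc (v j) (u j)}) := by
        refine measureReal_mono (fun ω ⟨h1, h2⟩ => ?_) (measure_ne_top _ _)
        simp only [orthantSet, Set.mem_ofPred_eq, not_forall, not_le] at h2
        obtain ⟨j, hj⟩ := h2
        simp only [Finset.mem_univ, Set.iUnion_true, Set.mem_iUnion]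
        exact ⟨j, hj, h1 j⟩
    _ ≤ ∑ j, P.real {ω | Uv P X 0 ω j ∈ Set.Ioc (v j) (u j)} :=
        measureReal_biUnion_finset_le _ _
    _ = _ := Finset.sum_congr rfl fun j _ =>
        measureReal_Uv_mem_Ioc hX hs hcont 0 j (hv j) (hvu j) (hu j)

/-- One-sided Lipschitz control of the empirical process between ordered points. -/
lemma alphan_sub_le (hX : ∀ i, Measurable (X i)) (hs : StrictlyStationary P X)
    (hcont : ∀ j, Continuous (margF P X j)) {n : ℕ} (hn : 1 ≤ n) {u v : Fin d → ℝ}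
    (hv : 0 ≤ v) (hvu : v ≤ u) (hu : u ≤ 1) (ω : Ω) :
    alphan P X n v ω - alphan P X n u ω ≤ √n * ∑ j, (u j - v j) := by
  have hn0 : (0 : ℝ) < n := by exact_mod_cast hn
  have h := measureReal_orthantSet_sdiff_le hX hs hcont hv hvu hu
  rw [← neg_sub, alphan_sub_eq_centredSum hX hcont hn hvu, ← mul_neg, centredSum,
    ← Finset.sum_neg_distrib]
  calc _ ≤ (√n)⁻¹ * ∑ i : Fin n, ∑ j, (u j - v j) := by
        gcongr with i
        have h1 : 0 ≤ (orthantSet P X u \ orthantSet P X v).indicator (fun _ => (1 : ℝ))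
            (X ((i : ℕ) + 1) ω) := Set.indicator_nonneg (fun _ _ => zero_le_one) _
        rw [centredIndic]
        linarith
    _ = _ := by
        rw [Finset.sum_const, Finset.card_univ, Fintype.card_fin, nsmul_eq_mul, ← mul_assoc,
          inv_mul_eq_div, Real.div_sqrt]

end Empirical

/-! ### Dyadic chaining -/

/-- The dyadic grid point `a / 2 ^ k`. -/
def gridPt (k : ℕ) (a : Fin d → ℕ) (j : Fin d) : ℝ := a j / 2 ^ k

/-- The index of the level-`k` dyadic grid point just below `u`. -/
def gridFloor (k : ℕ) (u : Fin d → ℝ) (j : Fin d) : ℕ := ⌊2 ^ k * u j⌋₊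

/-- Increments between neighbouring level-`k` dyadic grid points are at most `M ρ ^ k`, `k ≤ K`. -/
def GridBound (f : (Fin d → ℝ) → ℝ) (M ρ : ℝ) (K : ℕ) : Prop :=
  ∀ k ≤ K, ∀ a b : Fin d → ℕ, (∀ j, a j ≤ 2 ^ k) → (∀ j, b j ≤ a j) → (∀ j, a j ≤ b j + 1) →
    |f (gridPt k a) - f (gridPt k b)| ≤ M * ρ ^ k

lemma gridFloor_le {k : ℕ} {u : Fin d → ℝ} (hu : u ≤ 1) (j : Fin d) : gridFloor k u j ≤ 2 ^ k := by
  refine Nat.floor_le_of_le ?_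
  push_cast
  exact mul_le_of_le_one_right (by positivity) (hu j)

lemma gridPt_gridFloor_le {k : ℕ} {u : Fin d → ℝ} (hu : 0 ≤ u) : gridPt k (gridFloor k u) ≤ u := by
  intro j
  rw [gridPt, div_le_iff₀ (by positivity), mul_comm]
  exact Nat.floor_le (mul_nonneg (by positivity) (hu j))

lemma gridPt_succ (k : ℕ) (a : Fin d → ℕ) : gridPt (k + 1) (fun j => 2 * a j) = gridPt k a := by
  funext j
  simp only [gridPt, pow_succ']
  push_cast
  rw [mul_div_mul_left _ _ two_ne_zero]

lemma GridBound.abs_sub_succ_le {f : (Fin d → ℝ) → ℝ} {M ρ : ℝ} {K : ℕ} (h : GridBound f M ρ K)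
    {u : Fin d → ℝ} (hu0 : 0 ≤ u) (hu1 : u ≤ 1) {k : ℕ} (hk : k + 1 ≤ K) :
    |f (gridPt (k + 1) (gridFloor (k + 1) u)) - f (gridPt k (gridFloor k u))| ≤
      M * ρ ^ (k + 1) := by
  rw [← gridPt_succ k]
  refine h (k + 1) hk _ _ (gridFloor_le hu1) (fun j => ?_) (fun j => ?_)
  · refine Nat.le_floor ?_
    have := Nat.floor_le (mul_nonneg (by positivity : (0 : ℝ) ≤ 2 ^ k) (hu0 j))
    push_cast [gridFloor]
    rw [pow_succ']
    linarith
  · refine Nat.lt_succ_iff.1 ((Nat.floor_lt (mul_nonneg (by positivity) (hu0 j))).2 ?_)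
    have := Nat.lt_floor_add_one (2 ^ k * u j)
    push_cast [gridFloor]
    rw [pow_succ']
    linarith

lemma GridBound.abs_sub_chain_le {f : (Fin d → ℝ) → ℝ} {M ρ : ℝ} {K : ℕ} (h : GridBound f M ρ K)
    (hM : 0 ≤ M) (hρ0 : 0 ≤ ρ) (hρ1 : ρ < 1)
    {u : Fin d → ℝ} (hu0 : 0 ≤ u) (hu1 : u ≤ 1) {k : ℕ} (hk : k ≤ K) :
    |f (gridPt K (gridFloor K u)) - f (gridPt k (gridFloor k u))| ≤ M * ρ ^ k / (1 - ρ) := by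
  have h1ρ : 0 < 1 - ρ := by linarith
  have key : ∀ l, k ≤ l → l ≤ K →
      |f (gridPt l (gridFloor l u)) - f (gridPt k (gridFloor k u))| ≤
        M * ((ρ ^ k - ρ ^ l) * (ρ / (1 - ρ))) := by
    intro l hkl
    induction l, hkl using Nat.le_induction with
    | base => simp
    | succ l hkl ih =>
      intro hl
      have h1 := ih (by omega)
      have h2 := h.abs_sub_succ_le hu0 hu1 hl
      have h3 := abs_sub_le (f (gridPt (l + 1) (gridFloor (l + 1) u)))
        (f (gridPt l (gridFloor l u))) (f (gridPt k (gridFloor k u)))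
      have h4 : M * ρ ^ (l + 1) + M * ((ρ ^ k - ρ ^ l) * (ρ / (1 - ρ))) =
          M * ((ρ ^ k - ρ ^ (l + 1)) * (ρ / (1 - ρ))) := by
        field_simp
        ring
      linarith
  refine (key K hk le_rfl).trans ?_
  rw [mul_div_assoc]
  refine mul_le_mul_of_nonneg_left ?_ hM
  rw [← mul_div_assoc]
  refine div_le_div_of_nonneg_right ?_ h1ρ.le
  have e1 : 0 ≤ ρ ^ K := by positivity
  have e2 : 0 ≤ ρ ^ k := by positivity
  nlinarith

lemma GridBound.abs_sub_neighbour_le {f : (Fin d → ℝ) → ℝ} {M ρ : ℝ} {K : ℕ}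
    (h : GridBound f M ρ K) {u v : Fin d → ℝ} (hu : u ∈ Set.Icc 0 1) (hv : v ∈ Set.Icc 0 1)
    {k : ℕ} (hk : k ≤ K) (hd : dist u v ≤ (1 / 2) ^ k) :
    |f (gridPt k (gridFloor k u)) - f (gridPt k (gridFloor k v))| ≤ 2 * (M * ρ ^ k) := by
  have hnear : ∀ {x y : Fin d → ℝ}, 0 ≤ x → dist x y ≤ (1 / 2) ^ k → ∀ j,
      gridFloor k x j ≤ gridFloor k y j + 1 := by
    intro x y hx hxy j
    refine Nat.lt_succ_iff.1 ((Nat.floor_lt (mul_nonneg (by positivity) (hx j))).2 ?_)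
    have h1 := Nat.lt_floor_add_one (2 ^ k * y j)
    have h2 := ((dist_le_pi_dist x y j).trans hxy)
    rw [Real.dist_eq] at h2
    have h3 : 2 ^ k * (x j - y j) ≤ 1 :=
      calc 2 ^ k * (x j - y j) ≤ 2 ^ k * (1 / 2) ^ k := by gcongr; exact (le_abs_self _).trans h2
        _ = 1 := by rw [← mul_pow]; norm_num
    push_cast [gridFloor]
    linarith
  have hmin : ∀ j, gridFloor k u j ≤ min (gridFloor k u j) (gridFloor k v j) + 1 := fun j => by
    have := hnear hu.1 hd j
    omega
  have hmin' : ∀ j, gridFloor k v j ≤ min (gridFloor k u j) (gridFloor k v j) + 1 := fun j => by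
    have := hnear hv.1 (dist_comm u v ▸ hd) j
    omega
  have h1 := h k hk (gridFloor k u) (fun j => min (gridFloor k u j) (gridFloor k v j))
    (gridFloor_le hu.2) (fun j => min_le_left _ _) hmin
  have h2 := h k hk (gridFloor k v) (fun j => min (gridFloor k u j) (gridFloor k v j))
    (gridFloor_le hv.2) (fun j => min_le_right _ _) hmin'
  have h3 := abs_sub_le (f (gridPt k (gridFloor k u)))
    (f (gridPt k fun j => min (gridFloor k u j) (gridFloor k v j)))
    (f (gridPt k (gridFloor k v)))
  rw [abs_sub_comm] at h2
  linarith

lemma GridBound.abs_sub_gridFloor_le {f : (Fin d → ℝ) → ℝ} {M ρ N : ℝ} {K : ℕ}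
    (h : GridBound f M ρ K) (hN : 0 ≤ N)
    (hf : ∀ u v : Fin d → ℝ, 0 ≤ v → v ≤ u → u ≤ 1 → f v - f u ≤ N * ∑ j, (u j - v j))
    {u : Fin d → ℝ} (hu : u ∈ Set.Icc 0 1) (hM : 0 ≤ M * ρ ^ K) :
    |f u - f (gridPt K (gridFloor K u))| ≤ M * ρ ^ K + N * (d * (1 / 2) ^ K) := by
  set a := gridFloor K u with ha
  set b : Fin d → ℕ := fun j => min (a j + 1) (2 ^ K) with hb
  have hau : gridPt K a ≤ u := gridPt_gridFloor_le hu.1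
  have ha0 : 0 ≤ gridPt K a := fun j => by simp only [gridPt, Pi.zero_apply]; positivity
  have hab : ∀ j, a j ≤ b j := fun j => le_min (Nat.le_succ _) (gridFloor_le hu.2 j)
  have hub : u ≤ gridPt K b := by
    intro j
    rw [gridPt, le_div_iff₀ (by positivity), hb]
    push_cast
    refine le_min ?_ ?_
    · rw [mul_comm]
      exact (Nat.lt_floor_add_one _).le
    · exact mul_le_of_le_one_left (by positivity) (hu.2 j)
  have hb1 : gridPt K b ≤ 1 := by
    intro j
    rw [gridPt, div_le_iff₀ (by positivity), hb]
    push_cast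
    simp
  have hsum : ∑ j, (gridPt K b j - gridPt K a j) ≤ d * (1 / 2) ^ K := by
    calc _ ≤ ∑ _j : Fin d, ((1 : ℝ) / 2) ^ K := by
          refine Finset.sum_le_sum fun j _ => ?_
          rw [gridPt, gridPt, ← sub_div, div_pow, one_pow]
          gcongr
          have : (b j : ℝ) ≤ a j + 1 := by exact_mod_cast min_le_left _ _
          linarith
      _ = _ := by simp
  have hsum1 : ∑ j, (gridPt K b j - u j) ≤ d * (1 / 2) ^ K :=
    le_trans (Finset.sum_le_sum fun j _ => by linarith [hau j]) hsum
  have hsum2 : ∑ j, (u j - gridPt K a j) ≤ d * (1 / 2) ^ K :=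
    le_trans (Finset.sum_le_sum fun j _ => by linarith [hub j]) hsum
  have h1 := hf _ _ hu.1 hub hb1
  have h2 := hf _ _ ha0 hau hu.2
  have h3 := h K le_rfl b a (fun j => min_le_right _ _) hab (fun j => min_le_left _ _)
  have h4 := (abs_le.1 h3).2
  have h5 := mul_le_mul_of_nonneg_left hsum1 hN
  have h6 := mul_le_mul_of_nonneg_left hsum2 hN
  rw [abs_le]
  constructor <;> linarith

lemma GridBound.abs_sub_le {f : (Fin d → ℝ) → ℝ} {M ρ N : ℝ} {K : ℕ}
    (h : GridBound f M ρ K) (hM : 0 ≤ M) (hρ0 : 0 ≤ ρ) (hρ1 : ρ < 1) (hN : 0 ≤ N)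
    (hf : ∀ u v : Fin d → ℝ, 0 ≤ v → v ≤ u → u ≤ 1 → f v - f u ≤ N * ∑ j, (u j - v j))
    {u v : Fin d → ℝ} (hu : u ∈ Set.Icc 0 1) (hv : v ∈ Set.Icc 0 1) {k : ℕ} (hk : k ≤ K)
    (hd : dist u v ≤ (1 / 2) ^ k) :
    |f u - f v| ≤ M * ρ ^ k * (4 + 2 / (1 - ρ)) + 2 * (N * (d * (1 / 2) ^ K)) := by
  have h1 := h.abs_sub_gridFloor_le hN hf hu (by positivity)
  have h2 := h.abs_sub_gridFloor_le hN hf hv (by positivity)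
  have h3 := h.abs_sub_chain_le hM hρ0 hρ1 hu.1 hu.2 hk
  have h4 := h.abs_sub_chain_le hM hρ0 hρ1 hv.1 hv.2 hk
  have h5 := h.abs_sub_neighbour_le hu hv hk hd
  have h6 : M * ρ ^ K ≤ M * ρ ^ k :=
    mul_le_mul_of_nonneg_left (pow_le_pow_of_le_one hρ0 hρ1.le hk) hM
  have h7 : M * ρ ^ k * (4 + 2 / (1 - ρ)) = 4 * (M * ρ ^ k) + 2 * (M * ρ ^ k / (1 - ρ)) := by ring
  rw [abs_le] at h1 h2 h3 h4 h5 ⊢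
  constructor <;> linarith [h1.1, h1.2, h2.1, h2.2, h3.1, h3.2, h4.1, h4.2, h5.1, h5.2]

lemma exists_dyadic_scale {n : ℕ} (hn : 1 ≤ n) {r : ℝ} (hr1 : r ≤ 1) :
    ∃ k ≤ Nat.clog 2 n, r ≤ (1 / 2) ^ k ∧ (1 / 2 : ℝ) ^ k ≤ 2 * max r (n : ℝ)⁻¹ := by
  have hK : (1 / 2 : ℝ) ^ Nat.clog 2 n ≤ (n : ℝ)⁻¹ := by
    have h1 : (n : ℝ) ≤ 2 ^ Nat.clog 2 n := by exact_mod_cast Nat.le_pow_clog one_lt_two n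
    have hn0 : (0 : ℝ) < n := by exact_mod_cast hn
    rw [div_pow, one_pow, one_div]
    exact inv_anti₀ hn0 h1
  rcases le_or_gt r ((1 / 2) ^ Nat.clog 2 n) with h | h
  · refine ⟨_, le_rfl, h, ?_⟩
    have h2 := le_max_right r (n : ℝ)⁻¹
    have h3 : (0 : ℝ) ≤ (n : ℝ)⁻¹ := by positivity
    linarith
  · obtain ⟨k, hk1, hk2⟩ := exists_nat_pow_near_of_lt_one (lt_trans (by positivity) h) hr1
      (by norm_num : (0 : ℝ) < 1 / 2) (by norm_num)
    refine ⟨k, ?_, hk2, ?_⟩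
    · exact ((pow_lt_pow_iff_right_of_lt_one₀ (by norm_num : (0 : ℝ) < 1 / 2)
        (by norm_num)).1 (h.trans_le hk2)).le
    · rw [pow_succ] at hk1
      have h2 := le_max_left r (n : ℝ)⁻¹
      linarith

lemma GridBound.abs_sub_le_rpow {f : (Fin d → ℝ) → ℝ} {M ν : ℝ} {n : ℕ} (hn : 1 ≤ n)
    (hν0 : 0 < ν) (hν1 : ν < 1 / 2) (h : GridBound f M ((1 / 2) ^ ν) (Nat.clog 2 n)) (hM : 1 ≤ M)
    (hf : ∀ u v : Fin d → ℝ, 0 ≤ v → v ≤ u → u ≤ 1 → f v - f u ≤ √n * ∑ j, (u j - v j))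
    {u v : Fin d → ℝ} (hu : u ∈ Set.Icc 0 1) (hv : v ∈ Set.Icc 0 1) :
    |f u - f v| ≤ (2 * (4 + 2 / (1 - (1 / 2) ^ ν)) + 2 * d) * M *
      max (dist u v) (n : ℝ)⁻¹ ^ ν := by
  have hn0 : (0 : ℝ) < n := by exact_mod_cast hn
  have hn1 : (1 : ℝ) ≤ n := by exact_mod_cast hn
  have hdist : dist u v ≤ 1 := by
    refine (dist_pi_le_iff zero_le_one).2 fun j => ?_
    have := Real.dist_le_of_mem_Icc (x := u j) (y := v j) ⟨hu.1 j, hu.2 j⟩ ⟨hv.1 j, hv.2 j⟩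
    simpa using this
  obtain ⟨k, hkK, hk1, hk2⟩ := exists_dyadic_scale hn hdist
  set ρ : ℝ := (1 / 2) ^ ν with hρ
  set R := max (dist u v) (n : ℝ)⁻¹ with hR
  have hR0 : 0 < R := lt_of_lt_of_le (by positivity) (le_max_right _ _)
  have hρ0 : 0 ≤ ρ := by positivity
  have hρ1 : ρ < 1 := Real.rpow_lt_one (by norm_num) (by norm_num) hν0
  have h1ρ : 0 < 1 - ρ := by linarith
  have hb := h.abs_sub_le (by linarith) hρ0 hρ1 (Real.sqrt_nonneg _) hf hu hv hkK hk1
  have hρk : ρ ^ k ≤ 2 * R ^ ν := by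
    calc ρ ^ k = ((1 / 2 : ℝ) ^ k) ^ ν := by
          rw [hρ, ← Real.rpow_natCast, ← Real.rpow_natCast, ← Real.rpow_mul (by norm_num),
            ← Real.rpow_mul (by norm_num), mul_comm]
      _ ≤ (2 * R) ^ ν := by gcongr
      _ = 2 ^ ν * R ^ ν := Real.mul_rpow (by norm_num) hR0.le
      _ ≤ 2 * R ^ ν := by
          gcongr
          calc (2 : ℝ) ^ ν ≤ 2 ^ (1 : ℝ) :=
                Real.rpow_le_rpow_of_exponent_le (by norm_num) (by linarith)
            _ = 2 := Real.rpow_one 2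
  have hsq : √n * (1 / 2) ^ Nat.clog 2 n ≤ R ^ ν := by
    have h1 : (n : ℝ) ≤ 2 ^ Nat.clog 2 n := by exact_mod_cast Nat.le_pow_clog one_lt_two n
    calc √n * (1 / 2) ^ Nat.clog 2 n ≤ √n * (n : ℝ)⁻¹ := by
          rw [div_pow, one_pow, one_div]
          gcongr
      _ = (n : ℝ)⁻¹ ^ (1 / 2 : ℝ) := by
          rw [← Real.sqrt_eq_rpow, Real.sqrt_inv, ← div_eq_mul_inv, Real.sqrt_div_self]
      _ ≤ (n : ℝ)⁻¹ ^ ν :=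
          Real.rpow_le_rpow_of_exponent_ge (by positivity) (inv_le_one_of_one_le₀ hn1) hν1.le
      _ ≤ R ^ ν := by
          gcongr
          exact le_max_right _ _
  have hR' : 0 ≤ R ^ ν := by positivity
  have hc : 0 ≤ 4 + 2 / (1 - ρ) := by positivity
  calc |f u - f v| ≤ M * ρ ^ k * (4 + 2 / (1 - ρ)) + 2 * (√n * (d * (1 / 2) ^ Nat.clog 2 n)) := hb
    _ ≤ M * (2 * R ^ ν) * (4 + 2 / (1 - ρ)) + 2 * (d * R ^ ν) := by
        refine add_le_add (by gcongr) ?_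
        rw [mul_left_comm √n]
        gcongr
    _ ≤ M * (2 * R ^ ν) * (4 + 2 / (1 - ρ)) + 2 * (d * R ^ ν) * M := by
        have : 0 ≤ 2 * (d * R ^ ν) := by positivity
        nlinarith
    _ = _ := by ring

section Modulus

variable {P : Measure Ω} [IsProbabilityMeasure P] {X : ℤ → Ω → Fin d → ℝ}

/-- The pairs of neighbouring level-`k` dyadic grid indices. -/
def gridPairs (d k : ℕ) : Finset ((Fin d → ℕ) × (Fin d → ℕ)) :=
  {p ∈ Fintype.piFinset (fun _ => Finset.range (2 ^ k + 1)) ×ˢ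
      Fintype.piFinset (fun _ => Finset.range (2 ^ k + 1)) |
    (∀ j, p.2 j ≤ p.1 j) ∧ ∀ j, p.1 j ≤ p.2 j + 1}

lemma card_gridPairs_le (d k : ℕ) : ((gridPairs d k).card : ℝ) ≤ (2 ^ (k + 1)) ^ (2 * d) := by
  have h : (gridPairs d k).card ≤ (2 ^ (k + 1)) ^ (2 * d) := by
    refine (Finset.card_filter_le _ _).trans ?_
    rw [Finset.card_product, Fintype.card_piFinset_const, Finset.card_range, ← pow_add,
      ← two_mul]
    refine Nat.pow_le_pow_left ?_ _
    have := Nat.one_le_two_pow (n := k)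
    rw [pow_succ]
    omega
  exact_mod_cast h

lemma mem_gridPairs {k : ℕ} {a b : Fin d → ℕ} (ha : ∀ j, a j ≤ 2 ^ k) (hba : ∀ j, b j ≤ a j)
    (hab : ∀ j, a j ≤ b j + 1) : (a, b) ∈ gridPairs d k := by
  simp only [gridPairs, Finset.mem_filter, Finset.mem_product, Fintype.mem_piFinset,
    Finset.mem_range, Nat.lt_succ_iff]
  exact ⟨⟨ha, fun j => (hba j).trans (ha j)⟩, hba, hab⟩

lemma measureReal_gridPair_le (hX : ∀ i, Measurable (X i)) (hs : StrictlyStationary P X)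
    (hcont : ∀ j, Continuous (margF P X j)) {k : ℕ} {p : (Fin d → ℕ) × (Fin d → ℕ)}
    (hp : p ∈ gridPairs d k) :
    gridPt k p.2 ≤ gridPt k p.1 ∧
    P.real {ω | X 0 ω ∈ orthantSet P X (gridPt k p.1) \ orthantSet P X (gridPt k p.2)} ≤
      d * (1 / 2) ^ k := by
  simp only [gridPairs, Finset.mem_filter, Finset.mem_product, Fintype.mem_piFinset,
    Finset.mem_range, Nat.lt_succ_iff] at hp
  obtain ⟨⟨h1, h2⟩, h3, h4⟩ := hp
  have hle : gridPt k p.2 ≤ gridPt k p.1 := fun j => by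
    rw [gridPt, gridPt]
    gcongr
    exact h3 j
  refine ⟨hle, ?_⟩
  refine (measureReal_orthantSet_sdiff_le hX hs hcont (fun j => ?_) hle (fun j => ?_)).trans ?_
  · simp only [gridPt, Pi.zero_apply]
    positivity
  · simp only [gridPt, Pi.one_apply]
    rw [div_le_one (by positivity)]
    exact_mod_cast h1 j
  · calc _ ≤ ∑ _j : Fin d, ((1 : ℝ) / 2) ^ k := by
          refine Finset.sum_le_sum fun j _ => ?_
          rw [gridPt, gridPt, ← sub_div, div_pow, one_pow]
          gcongr
          have : (p.1 j : ℝ) ≤ p.2 j + 1 := by exact_mod_cast h4 j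
          linarith
      _ = _ := by simp

lemma exists_measureReal_gridPair_le (hX : ∀ i, Measurable (X i)) (hs : StrictlyStationary P X)
    (hcont : ∀ j, Continuous (margF P X j)) (hmix : ExpAlphaMixing P X) {ν : ℝ} (h0 : 0 < ν)
    (h1 : ν < 1 / 2) : ∃ C : ℝ, 0 ≤ C ∧ ∀ n : ℕ, 1 ≤ n → ∀ M : ℝ, 1 ≤ M →
      ∀ k ≤ Nat.clog 2 n, ∀ p ∈ gridPairs d k,
        P.real {ω | M * ((1 / 2 : ℝ) ^ ν) ^ k ≤
          |alphan P X n (gridPt k p.1) ω - alphan P X n (gridPt k p.2) ω|} ≤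
        C / M * ((1 / 2) ^ (2 * d + 1)) ^ k := by
  set κ : ℝ := (ν + 1 / 2) / 2 with hκ
  have hκν : 0 < κ - ν := by linarith
  set r : ℝ := (1 / 2) ^ (κ - ν) with hr
  have hr0 : 0 < r := by positivity
  have hr1 : r < 1 := Real.rpow_lt_one (by norm_num) (by norm_num) hκν
  obtain ⟨q, hq⟩ := exists_pow_lt_of_lt_one
    (by positivity : (0 : ℝ) < (1 / 2) ^ (2 * d + 1)) hr1
  set Q := q + 1 with hQ
  have hrQ : r ^ (2 * Q) ≤ (1 / 2) ^ (2 * d + 1) :=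
    (pow_le_pow_of_le_one hr0.le hr1.le (by omega)).trans hq.le
  obtain ⟨C, hC, h⟩ := exists_measureReal_centredSum_le hX hs hmix (κ := κ) (by linarith)
    (by linarith) Q
  refine ⟨C * ((d + 2 : ℝ) ^ κ) ^ (2 * Q), by positivity, fun n hn M hM k hk p hp => ?_⟩
  have hn0 : (0 : ℝ) < n := by exact_mod_cast hn
  have hM0 : 0 < M := by linarith
  obtain ⟨hle, hpr⟩ := measureReal_gridPair_le hX hs hcont hp
  simp only [alphan_sub_eq_centredSum hX hcont hn hle]
  have hnk : (n : ℝ)⁻¹ ≤ 2 * (1 / 2) ^ k := by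
    have h2 : (2 : ℝ) ^ k ≤ 2 * n := by
      rcases Nat.eq_zero_or_pos k with rfl | hk0
      · have : (1 : ℝ) ≤ n := by exact_mod_cast hn
        rw [pow_zero]
        linarith
      · have h3 : 2 ^ (k - 1) < n := (Nat.lt_clog_iff_pow_lt one_lt_two).1 (by omega)
        have h4 : 2 ^ k ≤ 2 * n := by
          obtain ⟨l, rfl⟩ : ∃ l, k = l + 1 := ⟨k - 1, by omega⟩
          rw [Nat.add_sub_cancel] at h3
          rw [pow_succ]
          omega
        exact_mod_cast h4
    rw [div_pow, one_pow, mul_one_div, le_div_iff₀ (by positivity), inv_mul_le_iff₀ hn0]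
    linarith
  have hz : 0 ≤ (1 / 2 : ℝ) ^ k := by positivity
  refine (h n _ ((d + 2) * (1 / 2) ^ k) _ ((measurableSet_orthantSet hcont _).diff
    (measurableSet_orthantSet hcont _)) hn (by positivity) ?_ (hpr.trans ?_)).trans ?_
  · have : 0 ≤ (d : ℝ) * (1 / 2) ^ k := by positivity
    linarith
  · linarith
  have e1 : ((1 / 2 : ℝ) ^ k) ^ κ = ((1 / 2 : ℝ) ^ ν) ^ k * r ^ k := by
    rw [← mul_pow, hr, ← Real.rpow_add (by norm_num), add_sub_cancel, ← Real.rpow_natCast,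
      ← Real.rpow_natCast, ← Real.rpow_mul (by norm_num), ← Real.rpow_mul (by norm_num), mul_comm]
  have e2 : ((d + 2 : ℝ) * (1 / 2) ^ k) ^ κ / (M * ((1 / 2 : ℝ) ^ ν) ^ k) =
      (d + 2 : ℝ) ^ κ * (M⁻¹ * r ^ k) := by
    rw [Real.mul_rpow (by positivity) (by positivity), e1]
    field_simp
  rw [e2, mul_pow, mul_pow, ← pow_mul r, mul_comm k, pow_mul r]
  have e3 : M⁻¹ ^ (2 * Q) ≤ M⁻¹ := by
    refine (pow_le_pow_of_le_one (by positivity) (inv_le_one_of_one_le₀ hM)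
      (by omega : 1 ≤ 2 * Q)).trans_eq (pow_one _)
  calc _ ≤ C * (((d + 2 : ℝ) ^ κ) ^ (2 * Q) * (M⁻¹ * ((1 / 2) ^ (2 * d + 1)) ^ k)) := by gcongr
    _ = _ := by rw [div_eq_mul_inv]; ring

/-- With high probability all dyadic increments of the empirical process are small. -/
lemma exists_measureReal_not_gridBound_le (hX : ∀ i, Measurable (X i))
    (hs : StrictlyStationary P X) (hcont : ∀ j, Continuous (margF P X j))
    (hmix : ExpAlphaMixing P X) {ν : ℝ} (h0 : 0 < ν) (h1 : ν < 1 / 2) :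
    ∃ C : ℝ, 0 ≤ C ∧ ∀ n : ℕ, 1 ≤ n → ∀ M : ℝ, 1 ≤ M →
      P.real {ω | ¬ GridBound (fun u => alphan P X n u ω) M ((1 / 2) ^ ν) (Nat.clog 2 n)} ≤
        C / M := by
  obtain ⟨C, hC, h⟩ := exists_measureReal_gridPair_le hX hs hcont hmix h0 h1
  refine ⟨C * 2 ^ (2 * d) * 2, by positivity, fun n hn M hM => ?_⟩
  have hM0 : 0 < M := by linarith
  set K := Nat.clog 2 n
  calc _ ≤ P.real (⋃ k ∈ Finset.range (K + 1), ⋃ p ∈ gridPairs d k,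
          {ω | M * ((1 / 2 : ℝ) ^ ν) ^ k ≤
            |alphan P X n (gridPt k p.1) ω - alphan P X n (gridPt k p.2) ω|}) := by
        refine measureReal_mono (fun ω hω => ?_) (measure_ne_top _ _)
        simp only [GridBound, Set.mem_ofPred_eq, not_forall, not_le] at hω
        obtain ⟨k, hk, a, b, ha, hba, hab, hlt⟩ := hω
        simp only [Set.mem_iUnion]
        exact ⟨k, Finset.mem_range.2 (Nat.lt_succ_of_le hk), (a, b), mem_gridPairs ha hba hab,
          hlt.le⟩
    _ ≤ ∑ k ∈ Finset.range (K + 1), ∑ p ∈ gridPairs d k,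
          P.real {ω | M * ((1 / 2 : ℝ) ^ ν) ^ k ≤
            |alphan P X n (gridPt k p.1) ω - alphan P X n (gridPt k p.2) ω|} :=
        (measureReal_biUnion_finset_le _ _).trans
          (Finset.sum_le_sum fun k _ => measureReal_biUnion_finset_le _ _)
    _ ≤ ∑ k ∈ Finset.range (K + 1), C / M * 2 ^ (2 * d) * (1 / 2) ^ k := by
        refine Finset.sum_le_sum fun k hk => ?_
        refine (Finset.sum_le_card_nsmul _ _ _
          (h n hn M hM k (Nat.lt_succ_iff.1 (Finset.mem_range.1 hk)))).trans ?_
        rw [nsmul_eq_mul]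
        calc _ ≤ ((2 : ℝ) ^ (k + 1)) ^ (2 * d) * (C / M * ((1 / 2) ^ (2 * d + 1)) ^ k) := by
              gcongr
              exact card_gridPairs_le d k
          _ = C / M * 2 ^ (2 * d) * (1 / 2) ^ k * ((2 ^ (2 * d)) ^ k * ((1 / 2) ^ (2 * d)) ^ k) := by
              ring
          _ = _ := by
              rw [← mul_pow, ← mul_pow]
              norm_num
    _ = C / M * 2 ^ (2 * d) * ∑ k ∈ Finset.range (K + 1), (1 / 2 : ℝ) ^ k := by
        rw [Finset.mul_sum]
    _ ≤ C / M * 2 ^ (2 * d) * 2 := by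
        gcongr
        exact (summable_geometric_two.sum_le_tsum _ fun _ _ => by positivity).trans_eq
          tsum_geometric_two
    _ = _ := by ring

/-- Hölder control of the empirical process at exponent `ν`, down to scale `1 / n`. -/
def HolderBound (P : Measure Ω) (X : ℤ → Ω → Fin d → ℝ) (n : ℕ) (ν M : ℝ) (ω : Ω) : Prop :=
  ∀ u ∈ Set.Icc (0 : Fin d → ℝ) 1, ∀ v ∈ Set.Icc (0 : Fin d → ℝ) 1,
    |alphan P X n u ω - alphan P X n v ω| ≤ M * max (dist u v) (n : ℝ)⁻¹ ^ ν

lemma exists_measure_not_holderBound_le (hX : ∀ i, Measurable (X i))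
    (hs : StrictlyStationary P X) (hcont : ∀ j, Continuous (margF P X j))
    (hmix : ExpAlphaMixing P X) {ν : ℝ} (h0 : 0 < ν) (h1 : ν < 1 / 2) {ε : ℝ} (hε : 0 < ε) :
    ∃ M : ℝ, 0 ≤ M ∧ ∀ n : ℕ, 1 ≤ n →
      P {ω | ¬ HolderBound P X n ν M ω} ≤ ENNReal.ofReal ε := by
  obtain ⟨C, hC, h⟩ := exists_measureReal_not_gridBound_le hX hs hcont hmix h0 h1
  have hρ1 : (1 / 2 : ℝ) ^ ν < 1 := Real.rpow_lt_one (by norm_num) (by norm_num) h0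
  have h1ρ : 0 < 1 - (1 / 2 : ℝ) ^ ν := by linarith
  set M := max 1 (C / ε)
  have hM : 1 ≤ M := le_max_left _ _
  refine ⟨(2 * (4 + 2 / (1 - (1 / 2) ^ ν)) + 2 * d) * M, by positivity, fun n hn => ?_⟩
  calc _ ≤ P {ω | ¬ GridBound (fun u => alphan P X n u ω) M ((1 / 2) ^ ν) (Nat.clog 2 n)} := by
        refine measure_mono fun ω hω hg => hω fun u hu v hv => ?_
        exact hg.abs_sub_le_rpow hn h0 h1 hM
          (fun u v hv hvu hu => alphan_sub_le hX hs hcont hn hv hvu hu ω) hu hv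
    _ ≤ ENNReal.ofReal ε := by
        rw [← ofReal_measureReal]
        refine ENNReal.ofReal_le_ofReal ((h n hn M hM).trans ?_)
        rw [div_le_iff₀ (by linarith), ← div_le_iff₀' hε]
        exact le_max_right _ _

end Modulus

/-! ### Suprema and the two conditions -/

lemma abs_biSup_le {α : Type*} {S : Set α} {f : α → ℝ} {a : ℝ} (ha : 0 ≤ a)
    (h0 : ∀ q ∈ S, 0 ≤ f q) (h : ∀ q ∈ S, f q ≤ a) : |⨆ q ∈ S, f q| ≤ a := by
  rw [abs_of_nonneg (Real.iSup_nonneg fun q => Real.iSup_nonneg fun hq => h0 q hq)]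
  exact Real.iSup_le (fun q => Real.iSup_le (fun hq => h q hq) ha) ha

section Conditions

variable {P : Measure Ω} {X : ℤ → Ω → Fin d → ℝ}

lemma HolderBound.abs_Mn_le {n : ℕ} (hn : 1 ≤ n) {μ ν M δ : ℝ} {ω : Ω}
    (h : HolderBound P X n ν M ω) (hM : 0 ≤ M) (hμ : 0 < μ) (hμν : μ < ν) :
    |Mn P X n δ μ ω| ≤ M * max δ (n : ℝ)⁻¹ ^ (ν - μ) := by
  have hn0 : (0 : ℝ) < n := by exact_mod_cast hn
  have hδ : 0 < max δ (n : ℝ)⁻¹ := lt_of_lt_of_le (by positivity) (le_max_right _ _)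
  refine abs_biSup_le (by positivity) (fun q _ => by positivity) ?_
  rintro ⟨u, v⟩ ⟨hu, hv, hd⟩
  dsimp only at hu hv hd ⊢
  set R := max (dist u v) (n : ℝ)⁻¹ with hR
  have hR0 : 0 < R := lt_of_lt_of_le (by positivity) (le_max_right _ _)
  have hden : max (dist u v ^ μ) ((n : ℝ) ^ (-μ)) = R ^ μ := by
    rw [Real.rpow_neg hn0.le, ← Real.inv_rpow hn0.le]
    rcases le_total (dist u v) (n : ℝ)⁻¹ with h' | h'
    · rw [hR, max_eq_right h', max_eq_right]
      exact Real.rpow_le_rpow dist_nonneg h' hμ.le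
    · rw [hR, max_eq_left h', max_eq_left]
      exact Real.rpow_le_rpow (by positivity) h' hμ.le
  rw [hden, div_le_iff₀ (by positivity)]
  calc _ ≤ M * R ^ ν := h u hu v hv
    _ = M * R ^ (ν - μ) * R ^ μ := by rw [mul_assoc, ← Real.rpow_add hR0, sub_add_cancel]
    _ ≤ _ := by
        have := sub_pos.2 hμν
        gcongr
        exact max_le_max hd le_rfl

lemma abs_le_mul_rpow_of_sqrt {n : ℕ} (hn : 1 ≤ n) {x y M ε w : ℝ} (hx0 : 0 < x) (hx1 : x ≤ 1)
    (hε0 : 0 < ε) (hε1 : ε ≤ 1) (hw0 : 0 < w) (hw1 : w < 1 / 2) (hM : 0 ≤ M)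
    (hsmall : x ≤ ε / n → |y| ≤ √n * x) (hy : |y| ≤ M * max x (n : ℝ)⁻¹ ^ w) :
    |y| ≤ (M / ε ^ w + 1) * x ^ w := by
  have hn0 : (0 : ℝ) < n := by exact_mod_cast hn
  have hxw : 0 < x ^ w := by positivity
  have hMw : 0 ≤ M / ε ^ w := by positivity
  rcases le_or_gt x (ε / n) with h | h
  · have h1 : √n * √x ≤ 1 := by
      rw [← Real.sqrt_mul hn0.le, Real.sqrt_le_one]
      rw [le_div_iff₀ hn0] at h
      linarith
    have h2 : √x ≤ x ^ w := by
      rw [Real.sqrt_eq_rpow]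
      exact Real.rpow_le_rpow_of_exponent_ge hx0 hx1 hw1.le
    calc |y| ≤ √n * x := hsmall h
      _ = √n * √x * √x := by rw [mul_assoc, Real.mul_self_sqrt hx0.le]
      _ ≤ 1 * x ^ w := by gcongr
      _ ≤ _ := by gcongr; linarith
  · have h1 : max x (n : ℝ)⁻¹ ≤ x / ε := by
      refine max_le (by rw [le_div_iff₀ hε0]; nlinarith) ?_
      rw [le_div_iff₀ hε0, inv_mul_eq_div]
      exact h.le
    calc |y| ≤ M * (x / ε) ^ w := hy.trans (by gcongr)
      _ = M / ε ^ w * x ^ w := by rw [Real.div_rpow hx0.le hε0.le]; ring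
      _ ≤ _ := by gcongr; linarith

lemma le_two_mul_rpow_mul_one_sub {s w L y : ℝ} (hs : s ∈ Set.Ioo (0 : ℝ) 1) (hw0 : 0 < w)
    (hw1 : w < 1) (hL : 0 ≤ L) (h1 : y ≤ L * s ^ w) (h2 : y ≤ L * (1 - s) ^ w) :
    y ≤ 2 * L * (s * (1 - s)) ^ w := by
  obtain ⟨hs0, hs1⟩ := hs
  have hs2 : 0 < 1 - s := by linarith
  have key : ∀ x : ℝ, 0 ≤ x → x ≤ 2 * (s * (1 - s)) → y ≤ L * x ^ w →
      y ≤ 2 * L * (s * (1 - s)) ^ w := by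
    intro x hx0 hx hy
    calc y ≤ L * (2 * (s * (1 - s))) ^ w := hy.trans (by gcongr)
      _ = L * (2 ^ w * (s * (1 - s)) ^ w) := by
          rw [Real.mul_rpow (by norm_num) (by positivity)]
      _ ≤ L * (2 * (s * (1 - s)) ^ w) := by
          gcongr
          exact (Real.rpow_le_rpow_of_exponent_le (by norm_num) hw1.le).trans_eq (Real.rpow_one 2)
      _ = _ := by ring
  rcases le_total s (1 / 2) with h | h
  · exact key s hs0.le (by nlinarith) h1
  · exact key (1 - s) hs2.le (by nlinarith) h2

/-- A weighted bound for the marginal empirical process. -/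
def WeightedBound (P : Measure Ω) (X : ℤ → Ω → Fin d → ℝ) (n : ℕ) (j : Fin d) (w L : ℝ)
    (ω : Ω) : Prop :=
  ∀ s ∈ Set.Ioo (0 : ℝ) 1, |alphanj P X n j s ω| ≤ L * (s * (1 - s)) ^ w

lemma Gnj_mono (n : ℕ) (j : Fin d) (ω : Ω) : Monotone fun x => Gnj P X n j x ω := by
  intro x y hxy
  refine mul_le_mul_of_nonneg_left (Finset.sum_le_sum fun i _ => ?_) (by positivity)
  exact Set.indicator_le_indicator_of_subset (fun ω' hω' => le_trans hω' hxy)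
    (fun _ => zero_le_one) ω

lemma WeightedBound.abs_betanj_le {n : ℕ} (hn : 1 ≤ n) {j : Fin d} {w L s : ℝ} {ω : Ω}
    (h : WeightedBound P X n j w L ω) (hw0 : 0 < w) (hw1 : w < 1) (hL : 0 ≤ L)
    (hs : s ∈ Set.Ioo (0 : ℝ) 1)
    (hsmall : 2 * ((2 * L + 1) * (s * (1 - s)) ^ w) ≤ √n * min s (1 - s)) :
    |betanj P X n j s ω| ≤ (2 * L + 1) * (s * (1 - s)) ^ w := by
  obtain ⟨hs0, hs1⟩ := hs
  have hs2 : 0 < 1 - s := by linarith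
  have hn0 : (0 : ℝ) < n := by exact_mod_cast hn
  have hsq : 0 < √(n : ℝ) := Real.sqrt_pos.2 hn0
  set p := (s * (1 - s)) ^ w with hp
  have hp0 : 0 < p := by positivity
  set t := (2 * L + 1) * p / √n with ht
  have ht0 : 0 < t := by positivity
  have hnt : √n * t = (2 * L + 1) * p := by rw [ht]; field_simp
  have htm : 2 * t ≤ min s (1 - s) := by
    rw [← hnt] at hsmall
    nlinarith
  have hts := htm.trans (min_le_left _ _)
  have hts' := htm.trans (min_le_right _ _)
  have key : ∀ x : ℝ, 0 < x → x < 1 → x * (1 - x) ≤ 2 * (s * (1 - s)) →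
      √n * |Gnj P X n j x ω - x| ≤ 2 * L * p := by
    intro x hx0 hx1 hx
    have hx2 : 0 < 1 - x := by linarith
    calc _ = |alphanj P X n j x ω| := by
          rw [alphanj, abs_mul, abs_of_pos hsq]
      _ ≤ L * (x * (1 - x)) ^ w := h x ⟨hx0, hx1⟩
      _ ≤ L * (2 * (s * (1 - s))) ^ w := by gcongr
      _ = L * (2 ^ w * p) := by rw [Real.mul_rpow (by norm_num) (by positivity)]
      _ ≤ L * (2 * p) := by
          gcongr
          exact (Real.rpow_le_rpow_of_exponent_le (by norm_num) hw1.le).trans_eq (Real.rpow_one 2)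
      _ = _ := by ring
  have hup := key (s + t) (by linarith) (by linarith) (by nlinarith)
  have hlo := key (s - t) (by linarith) (by linarith) (by nlinarith)
  have hmem : s ≤ Gnj P X n j (s + t) ω := by
    have h1 := neg_abs_le (Gnj P X n j (s + t) ω - (s + t))
    have h2 : |Gnj P X n j (s + t) ω - (s + t)| ≤ t := by
      refine le_of_mul_le_mul_left ?_ hsq
      linarith
    linarith
  have hbdd : ∀ y ∈ {x | s ≤ Gnj P X n j x ω}, s - t ≤ y := by
    intro y (hy : s ≤ Gnj P X n j y ω)
    by_contra! hlt
    have h1 : Gnj P X n j y ω ≤ Gnj P X n j (s - t) ω := Gnj_mono n j ω hlt.le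
    have h2 := le_abs_self (Gnj P X n j (s - t) ω - (s - t))
    have h3 : |Gnj P X n j (s - t) ω - (s - t)| < t := by
      refine lt_of_mul_lt_mul_left ?_ hsq.le
      linarith
    linarith
  have hinv : |genInv (fun x => Gnj P X n j x ω) s - s| ≤ t := by
    rw [genInv, if_neg hs0.ne']
    have h1 : sInf {x | s ≤ Gnj P X n j x ω} ≤ s + t := csInf_le ⟨_, hbdd⟩ hmem
    have h2 : s - t ≤ sInf {x | s ≤ Gnj P X n j x ω} := le_csInf ⟨_, hmem⟩ hbdd
    rw [abs_le]
    constructor <;> linarith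
  rw [betanj, abs_mul, abs_of_pos hsq, ← hnt]
  gcongr

lemma Uv_le_one [IsProbabilityMeasure P] (i : ℤ) (ω : Ω) (j : Fin d) : Uv P X i ω j ≤ 1 :=
  measureReal_le_one

variable [IsProbabilityMeasure P]

lemma alphanj_eq_alphan (hX : ∀ i, Measurable (X i)) (hcont : ∀ j, Continuous (margF P X j))
    (n : ℕ) (j : Fin d) {s : ℝ} (hs : s ∈ Set.Icc (0 : ℝ) 1) (ω : Ω) :
    alphanj P X n j s ω = alphan P X n (Function.update (fun _ => 1) j s) ω := by
  have hset : ∀ i, {ω' | ∀ k, Uv P X i ω' k ≤ Function.update (fun _ => (1 : ℝ)) j s k} =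
      {ω' | Uv P X i ω' j ≤ s} := by
    intro i
    ext ω'
    refine ⟨fun h => by simpa using h j, fun h k => ?_⟩
    rcases eq_or_ne k j with rfl | hk
    · simpa using h
    · simpa [hk] using Uv_le_one i ω' k
  have hcop : cop P X (Function.update (fun _ => (1 : ℝ)) j s) = s := by
    rw [cop, hset]
    exact measureReal_Uv_le hX hcont j hs
  simp only [alphanj, alphan, Gnj, Gn, hset, hcop]

lemma HolderBound.abs_alphanj_sub_le (hX : ∀ i, Measurable (X i))
    (hcont : ∀ j, Continuous (margF P X j)) {n : ℕ} {ν M : ℝ} {ω : Ω}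
    (h : HolderBound P X n ν M ω) (hM : 0 ≤ M) (hν : 0 < ν) (j : Fin d) {s t : ℝ}
    (hs : s ∈ Set.Icc (0 : ℝ) 1) (ht : t ∈ Set.Icc (0 : ℝ) 1) :
    |alphanj P X n j s ω - alphanj P X n j t ω| ≤ M * max |s - t| (n : ℝ)⁻¹ ^ ν := by
  have hmem : ∀ r ∈ Set.Icc (0 : ℝ) 1,
      Function.update (fun _ : Fin d => (1 : ℝ)) j r ∈ Set.Icc (0 : Fin d → ℝ) 1 := by
    intro r hr
    constructor <;> intro k <;> rcases eq_or_ne k j with rfl | hk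
    · simpa using hr.1
    · simp [hk]
    · simpa using hr.2
    · simp [hk]
  rw [alphanj_eq_alphan hX hcont n j hs, alphanj_eq_alphan hX hcont n j ht]
  refine (h _ (hmem s hs) _ (hmem t ht)).trans ?_
  gcongr
  refine (dist_pi_le_iff (abs_nonneg _)).2 fun k => ?_
  rcases eq_or_ne k j with rfl | hk
  · simp [Real.dist_eq]
  · simp [hk]

/-- All the marginal observations stay away from the endpoints by `η`. -/
def InteriorSample (P : Measure Ω) (X : ℤ → Ω → Fin d → ℝ) (n : ℕ) (j : Fin d) (η : ℝ)
    (ω : Ω) : Prop :=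
  ∀ i ∈ Finset.Icc (1 : ℤ) n, Uv P X i ω j ∈ Set.Ioc η (1 - η)

lemma measure_not_interiorSample_le (hX : ∀ i, Measurable (X i)) (hs : StrictlyStationary P X)
    (hcont : ∀ j, Continuous (margF P X j)) (n : ℕ) (j : Fin d) {η : ℝ}
    (hη : η ∈ Set.Icc (0 : ℝ) 1) :
    P {ω | ¬ InteriorSample P X n j η ω} ≤ ENNReal.ofReal (n * (2 * η)) := by
  have hm : MeasurableSet {x : Fin d → ℝ | margF P X j (x j) ≤ η} :=
    measurableSet_le ((hcont j).measurable.comp (measurable_pi_apply j)) measurable_const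
  have h1 : ∀ i, P.real {ω | Uv P X i ω j ≤ η} = η := fun i =>
    (hs.measureReal_eq hX hm i).trans (measureReal_Uv_le hX hcont j hη)
  have h2 : ∀ i, P.real {ω | Uv P X i ω j ∈ Set.Ioc (1 - η) 1} = η := fun i =>
    (measureReal_Uv_mem_Ioc hX hs hcont i j (by linarith [hη.2]) (by linarith [hη.1])
      le_rfl).trans (by ring)
  rw [← ofReal_measureReal]
  refine ENNReal.ofReal_le_ofReal ?_
  calc _ ≤ P.real (⋃ i ∈ Finset.Icc (1 : ℤ) n,
          ({ω | Uv P X i ω j ≤ η} ∪ {ω | Uv P X i ω j ∈ Set.Ioc (1 - η) 1})) := by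
        refine measureReal_mono (fun ω hω => ?_) (measure_ne_top _ _)
        simp only [InteriorSample, Set.mem_ofPred_eq, not_forall] at hω
        obtain ⟨i, hi, hout⟩ := hω
        simp only [Set.mem_iUnion]
        refine ⟨i, hi, ?_⟩
        rcases le_or_gt (Uv P X i ω j) η with h | h
        · exact Or.inl h
        · exact Or.inr ⟨not_le.1 fun h' => hout ⟨h, h'⟩, Uv_le_one i ω j⟩
    _ ≤ ∑ i ∈ Finset.Icc (1 : ℤ) n,
          P.real ({ω | Uv P X i ω j ≤ η} ∪ {ω | Uv P X i ω j ∈ Set.Ioc (1 - η) 1}) :=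
        measureReal_biUnion_finset_le _ _
    _ ≤ ∑ _i ∈ Finset.Icc (1 : ℤ) n, 2 * η := by
        refine Finset.sum_le_sum fun i _ => (measureReal_union_le _ _).trans ?_
        rw [h1, h2, two_mul]
    _ = n * (2 * η) := by simp

lemma Gnj_eq_zero {n : ℕ} {j : Fin d} {x : ℝ} {ω : Ω}
    (h : ∀ i ∈ Finset.Icc (1 : ℤ) n, x < Uv P X i ω j) : Gnj P X n j x ω = 0 := by
  have h0 : ∀ i ∈ Finset.Icc (1 : ℤ) n, indic {ω' | Uv P X i ω' j ≤ x} ω = 0 :=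
    fun i hi => Set.indicator_of_notMem (s := {ω' | Uv P X i ω' j ≤ x})
      (fun hω => not_le.2 (h i hi) hω) _
  rw [Gnj, Finset.sum_eq_zero h0, mul_zero]

lemma Gnj_eq_one {n : ℕ} (hn : 1 ≤ n) {j : Fin d} {x : ℝ} {ω : Ω}
    (h : ∀ i ∈ Finset.Icc (1 : ℤ) n, Uv P X i ω j ≤ x) : Gnj P X n j x ω = 1 := by
  have hn0 : (n : ℝ) ≠ 0 := by positivity
  have h1 : ∀ i ∈ Finset.Icc (1 : ℤ) n, indic {ω' | Uv P X i ω' j ≤ x} ω = 1 :=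
    fun i hi => Set.indicator_of_mem (s := {ω' | Uv P X i ω' j ≤ x}) (h i hi) _
  rw [Gnj, Finset.sum_congr rfl h1]
  simp [hn0]

lemma HolderBound.weightedBound (hX : ∀ i, Measurable (X i))
    (hcont : ∀ j, Continuous (margF P X j)) {n : ℕ} (hn : 1 ≤ n) {w M ε : ℝ} {ω : Ω}
    (h : HolderBound P X n w M ω) (hM : 0 ≤ M) (hw0 : 0 < w) (hw1 : w < 1 / 2) {j : Fin d}
    (hε0 : 0 < ε) (hε1 : ε ≤ 1) (hI : InteriorSample P X n j (ε / n) ω) :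
    WeightedBound P X n j w (2 * (M / ε ^ w + 1)) ω := by
  have hn0 : (0 : ℝ) < n := by exact_mod_cast hn
  have hη : 0 < ε / n := by positivity
  intro s hs
  have hs' : s ∈ Set.Icc (0 : ℝ) 1 := ⟨hs.1.le, hs.2.le⟩
  have hz0 : alphanj P X n j 0 ω = 0 := by
    rw [alphanj, Gnj_eq_zero fun i hi => hη.trans (hI i hi).1]
    simp
  have hz1 : alphanj P X n j 1 ω = 0 := by
    rw [alphanj, Gnj_eq_one hn fun i _ => Uv_le_one i ω j]
    simp
  have ha := h.abs_alphanj_sub_le hX hcont hM hw0 j hs' ⟨le_rfl, zero_le_one⟩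
  have hb := h.abs_alphanj_sub_le hX hcont hM hw0 j hs' ⟨zero_le_one, le_rfl⟩
  rw [hz0, sub_zero, sub_zero, abs_of_pos hs.1] at ha
  rw [hz1, sub_zero, abs_sub_comm s, abs_of_pos (sub_pos.2 hs.2)] at hb
  refine le_two_mul_rpow_mul_one_sub hs hw0 (by linarith) (by positivity)
    (abs_le_mul_rpow_of_sqrt hn hs.1 hs.2.le hε0 hε1 hw0 hw1 hM (fun hsm => ?_) ha)
    (abs_le_mul_rpow_of_sqrt hn (sub_pos.2 hs.2) (by linarith [hs.1]) hε0 hε1 hw0 hw1 hM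
      (fun hsm => ?_) hb)
  · rw [alphanj, Gnj_eq_zero fun i hi => hsm.trans_lt (hI i hi).1, abs_mul, zero_sub, abs_neg,
      abs_of_pos hs.1, abs_of_nonneg (Real.sqrt_nonneg _)]
  · rw [alphanj, Gnj_eq_one hn fun i hi => (hI i hi).2.trans (by linarith), abs_mul,
      abs_of_pos (sub_pos.2 hs.2), abs_of_nonneg (Real.sqrt_nonneg _)]

lemma exists_measure_not_weightedBound_le (hX : ∀ i, Measurable (X i))
    (hs : StrictlyStationary P X) (hcont : ∀ j, Continuous (margF P X j))
    (hmix : ExpAlphaMixing P X) {w : ℝ} (h0 : 0 < w) (h1 : w < 1 / 2) (j : Fin d) {ε : ℝ}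
    (hε : 0 < ε) : ∃ L : ℝ, 0 ≤ L ∧ ∀ n : ℕ, 1 ≤ n →
      P {ω | ¬ WeightedBound P X n j w L ω} ≤ ENNReal.ofReal ε := by
  obtain ⟨M, hM, h⟩ := exists_measure_not_holderBound_le hX hs hcont hmix h0 h1 (half_pos hε)
  set η := min 1 (ε / 4) with hη
  have hη0 : 0 < η := lt_min one_pos (by positivity)
  have hη1 : η ≤ 1 := min_le_left _ _
  refine ⟨2 * (M / η ^ w + 1), by positivity, fun n hn => ?_⟩
  have hn0 : (0 : ℝ) < n := by exact_mod_cast hn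
  have hn1 : (1 : ℝ) ≤ n := by exact_mod_cast hn
  calc _ ≤ P ({ω | ¬ HolderBound P X n w M ω} ∪ {ω | ¬ InteriorSample P X n j (η / n) ω}) := by
        refine measure_mono fun ω hω => ?_
        by_contra hc
        simp only [Set.mem_union, Set.mem_ofPred_eq, not_or, not_not] at hc
        exact hω (hc.1.weightedBound hX hcont hn hM h0 h1 hη0 hη1 hc.2)
    _ ≤ ENNReal.ofReal (ε / 2) + ENNReal.ofReal (n * (2 * (η / n))) :=
        (measure_union_le _ _).trans (add_le_add (h n hn)
          (measure_not_interiorSample_le hX hs hcont n j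
            ⟨by positivity, (div_le_one hn0).2 (hη1.trans hn1)⟩))
    _ ≤ ENNReal.ofReal ε := by
        rw [← ENNReal.ofReal_add (by positivity) (by positivity)]
        refine ENNReal.ofReal_le_ofReal ?_
        have h2 : (n : ℝ) * (2 * (η / n)) = 2 * η := by field_simp
        have h3 : η ≤ ε / 4 := min_le_right _ _
        linarith

lemma condition41_of_expAlphaMixing (hX : ∀ i, Measurable (X i))
    (hs : StrictlyStationary P X) (hcont : ∀ j, Continuous (margF P X j))
    (hmix : ExpAlphaMixing P X) : Condition41 P X (1 / 2) := by
  intro μ hμ δ hδ ε hε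
  obtain ⟨ν, hμν, hν⟩ := exists_between hμ.2
  rw [ENNReal.tendsto_nhds_zero]
  intro e he
  obtain ⟨e', he', hee⟩ : ∃ e' : ℝ, 0 < e' ∧ ENNReal.ofReal e' ≤ e := by
    obtain ⟨r, hr0, hr⟩ := ENNReal.lt_iff_exists_real_btwn.1 he
    exact ⟨r, ENNReal.ofReal_pos.1 hr.1, hr.2.le⟩
  obtain ⟨M, hM, h⟩ := exists_measure_not_holderBound_le hX hs hcont hmix (hμ.1.trans hμν) hν he'
  have hlim : Tendsto (fun n : ℕ => M * max (δ n) (n : ℝ)⁻¹ ^ (ν - μ)) atTop (nhds 0) := by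
    have h1 : Tendsto (fun n : ℕ => max (δ n) (n : ℝ)⁻¹) atTop (nhds (max 0 0)) :=
      hδ.max tendsto_inv_atTop_nhds_zero_nat
    have h2 := (h1.rpow_const (p := ν - μ) (Or.inr (sub_pos.2 hμν).le)).const_mul M
    rwa [max_self, Real.zero_rpow (sub_pos.2 hμν).ne', mul_zero] at h2
  filter_upwards [hlim.eventually_lt_const hε, eventually_ge_atTop 1] with n hn hn1
  refine (measure_mono fun ω hω hg => ?_).trans ((h n hn1).trans hee)
  have h3 : ε * 1 < |Mn P X n (δ n) μ ω| := hω
  have h4 := HolderBound.abs_Mn_le hn1 (δ := δ n) hg hM hμ.1 hμν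
  linarith

lemma mul_one_sub_mem_Ioc {s : ℝ} (hs : s ∈ Set.Ioo (0 : ℝ) 1) :
    s * (1 - s) ∈ Set.Ioc (0 : ℝ) 1 :=
  ⟨mul_pos hs.1 (sub_pos.2 hs.2), by nlinarith [hs.1, hs.2]⟩

lemma condition43_of_expAlphaMixing (hX : ∀ i, Measurable (X i))
    (hs : StrictlyStationary P X) (hcont : ∀ j, Continuous (margF P X j))
    (hmix : ExpAlphaMixing P X) : Condition43 P X (1 / 2) 1 := by
  intro w hw lam hlam j
  refine ⟨fun ε hε => ?_, fun ε hε => ?_⟩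
  · obtain ⟨L, hL, h⟩ := exists_measure_not_weightedBound_le hX hs hcont hmix hw.1 hw.2 j hε
    refine ⟨L, ?_⟩
    filter_upwards [eventually_ge_atTop 1] with n hn
    refine (measure_mono fun ω hω hg => ?_).trans (h n hn)
    rw [Set.mem_ofPred_eq, ← not_le] at hω
    refine hω ?_
    refine abs_biSup_le hL (fun s hs => ?_) (fun s hs => ?_)
    · have := (mul_one_sub_mem_Ioc hs).1
      positivity
    · have := (mul_one_sub_mem_Ioc hs).1
      rw [div_le_iff₀ (by positivity)]
      exact hg s hs
  · set v := max w (lam / 2) with hv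
    have hwv : w ≤ v := le_max_left _ _
    have hv0 : 0 < v := hw.1.trans_le hwv
    have hv1 : v < 1 / 2 := max_lt hw.2 (by linarith [hlam.2])
    have hexp : 0 < 1 / 2 - lam * (1 - v) := by
      have h1 : lam / 2 ≤ v := le_max_right _ _
      nlinarith [hlam.1, hlam.2, mul_le_mul_of_nonneg_left h1 hlam.1.le,
        mul_pos (sub_pos.2 hlam.2) (sub_pos.2 hlam.2)]
    obtain ⟨L, hL, h⟩ := exists_measure_not_weightedBound_le hX hs hcont hmix hv0 hv1 j hε
    refine ⟨2 * L + 1, ?_⟩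
    have hlarge := ((tendsto_rpow_atTop hexp).comp
      tendsto_natCast_atTop_atTop).eventually_ge_atTop (2 * (2 * L + 1))
    filter_upwards [hlarge, eventually_ge_atTop 1] with n hnl hn
    have hn0 : (0 : ℝ) < n := by exact_mod_cast hn
    have hnlam : 0 < (n : ℝ) ^ (-lam) := by positivity
    have hsub : ∀ s ∈ Set.Ioo ((n : ℝ) ^ (-lam)) (1 - (n : ℝ) ^ (-lam)), s ∈ Set.Ioo (0 : ℝ) 1 :=
      fun s hs => ⟨hnlam.trans hs.1, by linarith [hs.2]⟩
    refine (measure_mono fun ω hω hg => ?_).trans (h n hn)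
    rw [Set.mem_ofPred_eq, ← not_le] at hω
    refine hω ?_
    refine abs_biSup_le (by positivity) (fun s hs => ?_) (fun s hs => ?_)
    · have := (mul_one_sub_mem_Ioc (hsub s hs)).1
      positivity
    · obtain ⟨hp0, hp1⟩ := mul_one_sub_mem_Ioc (hsub s hs)
      set m := min s (1 - s) with hm
      have hml : (n : ℝ) ^ (-lam) ≤ m := le_min hs.1.le (by linarith [hs.2])
      have hm0 : 0 < m := hnlam.trans_le hml
      have hpm : s * (1 - s) ≤ m :=
        le_min (mul_le_of_le_one_right (hsub s hs).1.le (by linarith [(hsub s hs).1]))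
          (mul_le_of_le_one_left (by linarith [(hsub s hs).2]) (hsub s hs).2.le)
      have hsmall : 2 * ((2 * L + 1) * (s * (1 - s)) ^ v) ≤ √n * m := by
        calc _ = 2 * (2 * L + 1) * (s * (1 - s)) ^ v := by ring
          _ ≤ (n : ℝ) ^ (1 / 2 - lam * (1 - v)) * m ^ v := by gcongr; exact hnl
          _ = √n * (((n : ℝ) ^ (-lam)) ^ (1 - v) * m ^ v) := by
              rw [← Real.rpow_mul hn0.le, Real.sqrt_eq_rpow, ← mul_assoc, ← Real.rpow_add hn0]
              ring_nf
          _ ≤ √n * (m ^ (1 - v) * m ^ v) := by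
              gcongr
              linarith
          _ = √n * m := by rw [← Real.rpow_add hm0, sub_add_cancel, Real.rpow_one]
      rw [div_le_iff₀ (by positivity)]
      refine (hg.abs_betanj_le hn hv0 (by linarith) hL (hsub s hs) hsmall).trans ?_
      exact mul_le_mul_of_nonneg_left (Real.rpow_le_rpow_of_exponent_ge hp0 hp1 hwv)
        (by positivity)

end Conditions

/-- Proposition 4.4: exponential alpha-mixing implies Condition 4.1 with `θ₁ = 1/2`
and Condition 4.3 with `θ₂ = 1/2`, `θ₃ = 1`. -/
theorem conditions_hold_under_exponential_mixing
    {Ω : Type*} [MeasurableSpace Ω] {d : ℕ} (hd : 2 ≤ d)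
    (P : Measure Ω) [IsProbabilityMeasure P] (X : ℤ → Ω → Fin d → ℝ)
    (hmeas : ∀ i, Measurable (X i)) (hstat : StrictlyStationary P X)
    (hcont : ∀ j, Continuous (margF P X j))
    (hmix : ExpAlphaMixing P X) :
    Condition41 P X (1/2) ∧ Condition43 P X (1/2) 1 := by
  exact ⟨condition41_of_expAlphaMixing hmeas hstat hcont hmix,
    condition43_of_expAlphaMixing hmeas hstat hcont hmix⟩

end BBV
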